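/- arXiv:1602.01085 — 2 statements merged into one kernel-verified Lean document; each statement's English description precedes it below -/
import Mathlib

section
/- Fix s ∈ ℂ that is not zero or a negative integer, fix x ∈ ℝ with 0 < x ≤ 1, and fix N ∈ ℕ. Then, as q → 1⁻ (with q ∈ (0,1)), 𝓛_q(s,x) = Γ(1+s)·ζ(1+s,x)·(log(1/q))^(−(1+s)) − ∑_{k=0}^{N} (ζ(1−s−k)/k!)·B_k(x)·(log q)^(k−1) + O((log(1/q))^N). -/
open Filter Topology Asymptotics Finset Real


theorem lam_param {α : Type*} [MeasurableSpace α] {μ : MeasureTheory.Measure α} {U : Set ℂ}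
    (hU : IsOpen U) (F : ℂ → α → ℂ)
    (hmeas : ∀ z ∈ U, MeasureTheory.AEStronglyMeasurable (F z) μ)
    (hdiff : ∀ᵐ a ∂μ, DifferentiableOn ℂ (fun z => F z a) U)
    (hbd : ∀ z₀ ∈ U, ∃ ε > 0, ∃ bound : α → ℝ, MeasureTheory.Integrable bound μ ∧
      ∀ᵐ a ∂μ, ∀ z ∈ Metric.ball z₀ ε, ‖F z a‖ ≤ bound a) :
    DifferentiableOn ℂ (fun z => ∫ a, F z a ∂μ) U := by
  intro z₀ hz₀
  apply DifferentiableAt.differentiableWithinAt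
  obtain ⟨ε₁, hε₁, bound, hbi, hb⟩ := hbd z₀ hz₀
  obtain ⟨ε₂, hε₂, hball⟩ := Metric.isOpen_iff.1 hU z₀ hz₀
  set ε := min ε₁ ε₂ with hε
  have hεpos : 0 < ε := lt_min hε₁ hε₂
  have hsub : Metric.ball z₀ ε ⊆ U := (Metric.ball_subset_ball (min_le_right _ _)).trans hball
  have hderiv : ∀ᵐ a ∂μ, ∀ z ∈ Metric.ball z₀ ε, HasDerivAt (fun z => F z a)
      (deriv (fun z => F z a) z) z := by
    filter_upwards [hdiff] with a ha z hz
    exact ((ha z (hsub hz)).differentiableAt (hU.mem_nhds (hsub hz))).hasDerivAt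
  have hmem : z₀ ∈ Metric.ball z₀ ε := Metric.mem_ball_self hεpos
  refine (hasDerivAt_integral_of_dominated_loc_of_deriv_le (μ := μ) (F := F)
    (F' := fun z a => deriv (fun z => F z a) z) (x₀ := z₀) (s := Metric.ball z₀ (ε/2))
    (bound := fun a => bound a / (ε/4))
    (Metric.ball_mem_nhds _ (by positivity)) ?_ ?_ ?_ ?_ ?_ ?_).2.differentiableAt
  · filter_upwards [hU.mem_nhds hz₀] with z hz using hmeas z hz
  · refine hbi.mono' (hmeas _ hz₀) ?_
    filter_upwards [hb] with a ha
    exact ha _ (Metric.mem_ball_self hε₁)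
  · have hlim : Tendsto (fun n : ℕ => z₀ + (ε / 2 / ((n:ℝ) + 1) : ℝ)) atTop (𝓝[≠] z₀) := by
      rw [tendsto_nhdsWithin_iff]
      constructor
      · have h1 : Tendsto (fun n : ℕ => (ε/2) * (1 / ((n:ℝ) + 1))) atTop (𝓝 ((ε/2) * 0)) :=
          tendsto_one_div_add_atTop_nhds_zero_nat.const_mul _
        have h2 := (Complex.continuous_ofReal.tendsto _).comp h1
        have h3 := h2.const_add z₀
        simp only [mul_zero, Complex.ofReal_zero, add_zero] at h3
        refine h3.congr fun n => ?_
        simp [div_eq_mul_inv]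
      · refine Eventually.of_forall fun n => ?_
        simp only [Set.mem_compl_iff, Set.mem_singleton_iff, add_eq_left, Complex.ofReal_eq_zero]
        positivity
    refine aestronglyMeasurable_of_tendsto_ae (u := atTop) (f := fun n : ℕ => fun a =>
      slope (fun z => F z a) z₀ (z₀ + (ε / 2 / ((n:ℝ) + 1) : ℝ))) ?_ ?_
    · intro n
      have hin : z₀ + ((ε / 2 / ((n:ℝ) + 1) : ℝ):ℂ) ∈ U := by
        apply hsub
        rw [Metric.mem_ball, dist_eq_norm, add_sub_cancel_left, Complex.norm_real, Real.norm_eq_abs,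
          abs_of_pos (by positivity)]
        have : ε / 2 / ((n:ℝ)+1) ≤ ε / 2 := div_le_self (by positivity) (by linarith [(Nat.cast_nonneg n : (0:ℝ) ≤ n)])
        linarith
      simp only [slope_def_field, div_eq_mul_inv]
      exact ((hmeas _ hin).sub (hmeas _ hz₀)).mul_const _
    · filter_upwards [hderiv] with a ha
      exact (hasDerivAt_iff_tendsto_slope.1 (ha z₀ hmem)).comp hlim
  · filter_upwards [hb, hdiff] with a ha hd z hz
    have hcb : Metric.closedBall z (ε/4) ⊆ Metric.ball z₀ ε := by
      apply Metric.closedBall_subset_ball'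
      rw [Metric.mem_ball] at hz
      linarith
    refine Complex.norm_deriv_le_of_forall_mem_sphere_norm_le (by positivity) ?_ ?_
    · apply DifferentiableOn.diffContOnCl
      rw [closure_ball _ (by positivity)]
      exact hd.mono (hcb.trans hsub)
    · intro w hw
      exact ha w (Metric.ball_subset_ball (min_le_left _ _) (hcb (Metric.sphere_subset_closedBall hw)))
  · exact hbi.div_const _
  · filter_upwards [hderiv] with a ha z hz
    exact ha z (Metric.ball_subset_ball (by linarith) hz)

/-- Gamma integral with complex scaling. -/
theorem lam_gamma {a : ℂ} (ha : 0 < a.re) {r : ℂ} (hr : 0 < r.re) :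
    ∫ y : ℝ in Set.Ioi 0, (y : ℂ) ^ (a - 1) * Complex.exp (-(r * y)) = r ^ (-a) * Complex.Gamma a := by
  set U : Set ℂ := {r | 0 < r.re} with hUdef
  have hU : IsOpen U := isOpen_lt continuous_const Complex.continuous_re
  have hconv : Convex ℝ U := convex_halfSpace_re_gt 0
  have hmeas : ∀ z : ℂ, MeasureTheory.AEStronglyMeasurable (fun y : ℝ => (y : ℂ) ^ (a - 1) * Complex.exp (-(z * y)))
      (MeasureTheory.volume.restrict (Set.Ioi 0)) := by
    intro z
    apply ContinuousOn.aestronglyMeasurable _ measurableSet_Ioi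
    apply ContinuousOn.mul
    · intro y hy
      apply ContinuousAt.continuousWithinAt
      exact (Complex.continuous_ofReal.continuousAt).cpow continuousAt_const (Or.inl (by simpa using hy))
    · fun_prop
  have h1 : DifferentiableOn ℂ (fun r : ℂ => ∫ y : ℝ in Set.Ioi 0, (y : ℂ) ^ (a - 1) * Complex.exp (-(r * y))) U := by
    apply lam_param hU
    · intro z hz; exact hmeas z
    · refine Eventually.of_forall fun y => ?_
      fun_prop
    · intro z₀ hz₀
      refine ⟨z₀.re/2, by simp only [hUdef, Set.mem_ofPred_eq] at hz₀; positivity, fun y => y ^ (a.re - 1) * Real.exp (-((z₀.re/2) * y)), ?_, ?_⟩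
      · have h := integrableOn_rpow_mul_exp_neg_mul_rpow (s := a.re - 1) (p := 1) (b := z₀.re/2) (by linarith) one_pos (by simp only [hUdef, Set.mem_ofPred_eq] at hz₀; positivity)
        simpa [MeasureTheory.IntegrableOn] using h
      · filter_upwards [MeasureTheory.ae_restrict_mem measurableSet_Ioi] with y hy z hz
        rw [norm_mul, Complex.norm_cpow_eq_rpow_re_of_pos hy, Complex.norm_exp]
        simp only [Complex.sub_re, Complex.one_re, Complex.neg_re, Complex.mul_re, Complex.ofReal_re, Complex.ofReal_im, mul_zero, sub_zero]
        have h2 : |(z - z₀).re| < z₀.re / 2 := (Complex.abs_re_le_norm _).trans_lt (by simpa [dist_eq_norm] using hz)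
        rw [Complex.sub_re] at h2
        have h3 := (abs_lt.1 h2).1
        have hy' : 0 < y := hy
        gcongr
        linarith
  have h2 : DifferentiableOn ℂ (fun r : ℂ => r ^ (-a) * Complex.Gamma a) U := by
    intro z hz
    apply DifferentiableAt.differentiableWithinAt
    apply DifferentiableAt.mul_const
    exact differentiableAt_id.cpow_const (Or.inl hz)
  refine (h1.analyticOnNhd hU).eqOn_of_preconnected_of_frequently_eq (h2.analyticOnNhd hU) hconv.isPreconnected (z₀ := 1) (by simp [hUdef]) ?_ hr
  have hlim : Tendsto (fun n : ℕ => ((1 + 1 / ((n:ℝ) + 1) : ℝ) : ℂ)) atTop (𝓝[≠] 1) := by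
    rw [tendsto_nhdsWithin_iff]
    constructor
    · have h3 := (Complex.continuous_ofReal.tendsto _).comp
        ((tendsto_one_div_add_atTop_nhds_zero_nat (𝕜 := ℝ)).const_add 1)
      simpa [Function.comp_def] using h3
    · refine Eventually.of_forall fun n => ?_
      simp only [Set.mem_compl_iff, Set.mem_singleton_iff]
      rw [← Complex.ofReal_one, Complex.ofReal_inj]
      have : (0:ℝ) < 1 / ((n:ℝ)+1) := by positivity
      intro h
      linarith
  refine hlim.frequently (Frequently.of_forall fun n => ?_)
  have hp : (0:ℝ) < 1 + 1 / ((n:ℝ)+1) := by positivity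
  have h := Complex.integral_cpow_mul_exp_neg_mul_Ioi ha hp
  rw [h, Complex.cpow_neg, one_div, Complex.inv_cpow]
  rw [Complex.arg_ofReal_of_nonneg hp.le]
  exact Real.pi_pos.ne


noncomputable def lamZ (v : ℝ) (m : ℤ) : ℂ := (v : ℂ) + 2 * π * Complex.I * m

theorem lamZ_re (v : ℝ) (m : ℤ) : (lamZ v m).re = v := by
  simp [lamZ]

theorem lamZ_im (v : ℝ) (m : ℤ) : (lamZ v m).im = 2 * π * m := by
  simp [lamZ]

theorem lam_cpow_bound {s : ℂ} (hs : 3 ≤ s.re) (v : ℝ) {m : ℤ} (M : ℕ) (hm : |(m : ℝ)| = (M : ℝ) + 1) :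
    ‖(lamZ v m) ^ (-1 - s)‖ ≤ Real.exp (π * |s.im|) * ((1 + |v|) ^ 2)⁻¹ * (((M:ℝ) + 1) ^ 2)⁻¹ := by
  set z := lamZ v m with hz
  have hM : (1:ℝ) ≤ (M:ℝ) + 1 := by linarith [(Nat.cast_nonneg M : (0:ℝ) ≤ M)]
  have hsq : ‖z‖ ^ 2 = v ^ 2 + 4 * π ^ 2 * ((M:ℝ)+1) ^ 2 := by
    rw [← Complex.normSq_eq_norm_sq, Complex.normSq_apply, lamZ_re, lamZ_im, ← hm, sq_abs]; ring
  have hge : (1 + |v|) * ((M:ℝ)+1) ≤ ‖z‖ ^ 2 := by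
    rw [hsq, ← sq_abs v]
    have : (3:ℝ) < π := Real.pi_gt_three
    nlinarith [sq_nonneg (|v| - ((M:ℝ)+1)), abs_nonneg v, mul_pos (by linarith : (0:ℝ) < (M:ℝ)+1) (by linarith : (0:ℝ) < (M:ℝ)+1),
      mul_nonneg (sq_nonneg ((M:ℝ)+1)) (by nlinarith : (0:ℝ) ≤ π^2 - 9)]
  have hz1 : 1 ≤ ‖z‖ := by
    have h1 : 1 ≤ ‖z‖ ^ 2 := by
      refine le_trans ?_ hge
      nlinarith [abs_nonneg v]
    nlinarith [norm_nonneg z]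
  have h1 := Complex.norm_cpow_le z (-1 - s)
  refine h1.trans ?_
  have h2 : ‖z‖ ^ ((-1 - s).re) ≤ ((1 + |v|) ^ 2)⁻¹ * (((M:ℝ) + 1) ^ 2)⁻¹ := by
    calc ‖z‖ ^ ((-1 - s).re) ≤ ‖z‖ ^ (-(4:ℕ) : ℝ) := by
          apply Real.rpow_le_rpow_of_exponent_le hz1
          simp; linarith
      _ = ((‖z‖ ^ 2) ^ 2)⁻¹ := by
          rw [Real.rpow_neg (norm_nonneg z), Real.rpow_natCast, ← pow_mul]
      _ ≤ (((1 + |v|) * ((M:ℝ)+1)) ^ 2)⁻¹ := by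
          have : 0 < (1 + |v|) * ((M:ℝ)+1) := by positivity
          gcongr
      _ = _ := by rw [mul_pow, mul_inv]
  have h3 : (Real.exp (z.arg * (-1 - s).im))⁻¹ ≤ Real.exp (π * |s.im|) := by
    rw [← Real.exp_neg]
    apply Real.exp_le_exp.2
    calc -(z.arg * (-1 - s).im) ≤ |z.arg * s.im| := by
          simp only [Complex.sub_im, Complex.neg_im, Complex.one_im, neg_zero, zero_sub, mul_neg, neg_neg]
          exact le_abs_self _
      _ = |z.arg| * |s.im| := abs_mul _ _
      _ ≤ π * |s.im| := by gcongr; exact Complex.abs_arg_le_pi z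
  rw [div_eq_mul_inv, mul_comm]
  calc _ ≤ Real.exp (π * |s.im|) * (((1 + |v|) ^ 2)⁻¹ * (((M:ℝ) + 1) ^ 2)⁻¹) := by gcongr
    _ = _ := by ring

noncomputable def psiT (s : ℂ) (v : ℝ) (m : ℕ) : ℂ :=
  (lamZ v (m + 1)) ^ (-1 - s) + (lamZ v (-(m + 1))) ^ (-1 - s)

theorem abs_cast_aux (m : ℕ) : |(((m:ℤ) + 1 : ℤ) : ℝ)| = (m : ℝ) + 1 := by
  push_cast; exact abs_of_pos (by positivity)

theorem abs_cast_aux' (m : ℕ) : |((-((m:ℤ) + 1) : ℤ) : ℝ)| = (m : ℝ) + 1 := by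
  push_cast; rw [abs_neg]; exact abs_of_pos (by positivity)

theorem psiT_bound {s : ℂ} (hs : 3 ≤ s.re) (v : ℝ) (m : ℕ) :
    ‖psiT s v m‖ ≤ 2 * Real.exp (π * |s.im|) * ((1 + |v|) ^ 2)⁻¹ * (((m:ℝ) + 1) ^ 2)⁻¹ := by
  have h1 := lam_cpow_bound hs v m (abs_cast_aux m)
  have h2 := lam_cpow_bound hs v m (abs_cast_aux' m)
  refine (norm_add_le _ _).trans ?_
  linarith

theorem summable_inv_sq : Summable (fun m : ℕ => (((m:ℝ) + 1) ^ 2)⁻¹) := by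
  have h := (summable_nat_add_iff 1 (f := fun m : ℕ => ((m:ℝ)^2)⁻¹)).2 (Real.summable_nat_pow_inv.2 one_lt_two)
  simpa using h

theorem summable_psiT {s : ℂ} (hs : 3 ≤ s.re) (v : ℝ) : Summable (psiT s v) :=
  Summable.of_norm_bounded (summable_inv_sq.mul_left _) (psiT_bound hs v)

noncomputable def Psi (s : ℂ) (v : ℝ) : ℂ := Complex.Gamma (1 + s) * ∑' m, psiT s v m

noncomputable def PsiC (s : ℂ) : ℝ :=
  ‖Complex.Gamma (1 + s)‖ * (2 * Real.exp (π * |s.im|) * ∑' m : ℕ, (((m:ℝ) + 1) ^ 2)⁻¹)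

theorem Psi_bound {s : ℂ} (hs : 3 ≤ s.re) (v : ℝ) : ‖Psi s v‖ ≤ PsiC s * ((1 + |v|) ^ 2)⁻¹ := by
  rw [Psi, norm_mul, PsiC, mul_assoc]
  gcongr
  have h := tsum_of_norm_bounded ((summable_inv_sq.mul_left (2 * Real.exp (π * |s.im|) * ((1 + |v|) ^ 2)⁻¹)).hasSum) (psiT_bound hs v)
  rw [tsum_mul_left] at h
  linarith

theorem lamZ_slit (v : ℝ) {m : ℤ} (hm : m ≠ 0) : lamZ v m ∈ Complex.slitPlane := by
  right
  rw [lamZ_im]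
  have : (m:ℝ) ≠ 0 := by exact_mod_cast hm
  positivity

theorem hasDerivAt_lamZ_cpow (w : ℂ) (v : ℝ) {m : ℤ} (hm : m ≠ 0) :
    HasDerivAt (fun v : ℝ => (lamZ v m) ^ w) (w * (lamZ v m) ^ (w - 1)) v := by
  have h1 : HasDerivAt (fun z : ℂ => z + 2 * π * Complex.I * m) 1 (v : ℂ) := (hasDerivAt_id _).add_const _
  have h2 := (h1.cpow_const (c := w) (lamZ_slit v hm)).comp_ofReal
  simpa [lamZ] using h2

theorem hasDerivAt_psiT (s : ℂ) (v : ℝ) (m : ℕ) :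
    HasDerivAt (fun v => psiT s v m) (-(1 + s) * psiT (s + 1) v m) v := by
  have h := (hasDerivAt_lamZ_cpow (-1 - s) v (m := (m:ℤ)+1) (by omega)).add
    (hasDerivAt_lamZ_cpow (-1 - s) v (m := -((m:ℤ)+1)) (by omega))
  refine h.congr_deriv ?_
  rw [psiT, show -1 - (s + 1) = -1 - s - 1 by ring]
  ring

theorem hasDerivAt_Psi {s : ℂ} (hs : 3 ≤ s.re) (v : ℝ) : HasDerivAt (Psi s) (-Psi (s + 1) v) v := by
  have hs1 : 3 ≤ (s + 1).re := by simp; linarith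
  have h := hasDerivAt_tsum (u := fun m : ℕ => ‖-(1+s)‖ * (2 * Real.exp (π * |(s+1).im|) * (((m:ℝ) + 1) ^ 2)⁻¹))
    (g := fun m v => psiT s v m) (g' := fun m v => -(1 + s) * psiT (s + 1) v m) (y₀ := v)
    ((summable_inv_sq.mul_left _).mul_left _) (fun m v => hasDerivAt_psiT s v m) ?_ (summable_psiT hs v) v
  · have h2 := h.const_mul (Complex.Gamma (1 + s))
    refine h2.congr_deriv ?_
    have hne : (1 + s) ≠ 0 := by
      intro h0
      have := congrArg Complex.re h0
      simp at this; linarith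
    rw [Psi, show (1 : ℂ) + (s + 1) = (1 + s) + 1 by ring, Complex.Gamma_add_one _ hne, tsum_mul_left]
    ring
  · intro m v
    rw [norm_mul]
    gcongr
    refine (psiT_bound hs1 v m).trans ?_
    have : ((1 + |v|)^2)⁻¹ ≤ 1 := by
      apply inv_le_one_of_one_le₀
      nlinarith [abs_nonneg v]
    calc _ = 2 * Real.exp (π * |(s+1).im|) * (((m:ℝ) + 1) ^ 2)⁻¹ * ((1 + |v|)^2)⁻¹ := by ring
      _ ≤ _ := mul_le_of_le_one_right (by positivity) this

theorem Psi_zero {s : ℂ} (hs : 3 ≤ s.re) : Psi s 0 = riemannZeta (-s) := by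
  have hre : 1 < (1 + s).re := by simp; linarith
  have h1 := riemannZeta_one_sub (s := 1 + s) (fun n h => by
    have := congrArg Complex.re h
    simp at this; linarith [(Nat.cast_nonneg n : (0:ℝ) ≤ n)]) (fun h => by
    have := congrArg Complex.re h
    simp at this; linarith)
  rw [show 1 - (1 + s) = -s by ring] at h1
  rw [h1, zeta_eq_tsum_one_div_nat_add_one_cpow hre, Psi]
  have hterm : ∀ m : ℕ, psiT s 0 m = (2 * (2 * π : ℂ) ^ (-(1+s)) * Complex.cos (π * (1 + s) / 2)) * (1 / ((m:ℂ) + 1) ^ (1 + s)) := by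
    intro m
    have e1 : lamZ 0 ((m:ℤ)+1) = ((2 * π * ((m:ℝ) + 1) : ℝ) : ℂ) * Complex.I := by
      simp [lamZ]; ring
    have e2 : lamZ 0 (-((m:ℤ)+1)) = ((2 * π * ((m:ℝ) + 1) : ℝ) : ℂ) * (-Complex.I) := by
      simp [lamZ]; ring
    have hpos : (0:ℝ) < 2 * π * ((m:ℝ) + 1) := by positivity
    have e3 : (((2 * π * ((m:ℝ) + 1) : ℝ) : ℂ)) ^ (-(1+s)) = (2 * π : ℂ) ^ (-(1+s)) * (1 / ((m:ℂ) + 1) ^ (1 + s)) := by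
      rw [Complex.ofReal_mul, Complex.mul_cpow_ofReal_nonneg (by positivity) (by positivity), Complex.cpow_neg (((m:ℝ)+1 : ℝ):ℂ)]
      push_cast
      rw [one_div]
    have hI : Complex.I ^ (-(1+s)) + (-Complex.I) ^ (-(1+s)) = 2 * Complex.cos (π * (1 + s) / 2) := by
      rw [Complex.cpow_def_of_ne_zero Complex.I_ne_zero, Complex.cpow_def_of_ne_zero (neg_ne_zero.2 Complex.I_ne_zero),
        Complex.log_I, Complex.log_neg_I, Complex.cos]
      rw [add_comm]
      have a1 : -(↑π / 2) * Complex.I * -(1 + s) = π * (1 + s) / 2 * Complex.I := by ring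
      have a2 : (↑π / 2) * Complex.I * -(1 + s) = -(π * (1 + s) / 2) * Complex.I := by ring
      rw [a1, a2]
      ring
    have m1 : ∀ (r : ℝ) (hr : 0 < r) (z : ℂ) (hz : z ≠ 0) (w : ℂ), ((r:ℂ) * z) ^ w = (r:ℂ) ^ w * z ^ w := by
      intro r hr z hz w
      have hr0 : (r:ℂ) ≠ 0 := by exact_mod_cast hr.ne'
      rw [Complex.cpow_def_of_ne_zero (mul_ne_zero hr0 hz), Complex.cpow_def_of_ne_zero hr0, Complex.cpow_def_of_ne_zero hz,
        Complex.log_ofReal_mul hr hz, ← Complex.exp_add, add_mul, Complex.ofReal_log hr.le]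
    rw [psiT, e1, e2, show -1 - s = -(1+s) by ring, m1 _ hpos _ Complex.I_ne_zero, m1 _ hpos _ (neg_ne_zero.2 Complex.I_ne_zero), e3,
      ← mul_add, hI]
    ring
  simp_rw [hterm]
  rw [tsum_mul_left]
  ring


set_option maxHeartbeats 2000000 in
open scoped FourierTransform in
theorem lam_poisson {s : ℂ} (hs : 3 ≤ s.re) {v : ℝ} (hv : 0 < v) :
    ∑' k : ℕ, ((k : ℂ) + 1) ^ s * ((Real.exp (-(((k:ℝ) + 1) * v)) : ℝ) : ℂ) =
      Psi s v + Complex.Gamma (1 + s) * (v : ℂ) ^ (-(1 + s)) := by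
  have hs0 : s ≠ 0 := by
    intro h; rw [h] at hs; simp at hs; linarith
  set g : ℝ → ℂ := fun y => ((max y 0 : ℝ) : ℂ) ^ s * Complex.exp (-(v * y)) with hg
  have hneg : ∀ y : ℝ, y ≤ 0 → g y = 0 := by
    intro y hy
    simp [hg, max_eq_right hy, Complex.zero_cpow hs0]
  have hpos : ∀ y : ℝ, 0 < y → g y = (y : ℂ) ^ s * Complex.exp (-(v * y)) := by
    intro y hy
    simp [hg, max_eq_left hy.le]
  have hgc : Continuous g := by
    refine Continuous.mul ?_ (by fun_prop)
    exact (Complex.continuous_ofReal_cpow_const (y := s) (by linarith)).comp (by fun_prop : Continuous fun y : ℝ => max y 0)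
  have hdecay : g =O[cocompact ℝ] fun y : ℝ => |y| ^ (-(2:ℝ)) := by
    rw [cocompact_eq_atBot_atTop, isBigO_sup]
    constructor
    · refine IsBigO.of_bound 0 ?_
      filter_upwards [eventually_le_atBot 0] with y hy
      rw [hneg y hy]; simp
    · have h1 := (isLittleO_exp_neg_mul_rpow_atTop hv (-(2:ℝ) - s.re)).isBigO
      obtain ⟨c, hc⟩ := h1.bound
      refine IsBigO.of_bound c ?_
      filter_upwards [hc, eventually_gt_atTop 0] with y hy hy0
      rw [hpos y hy0, norm_mul, Complex.norm_cpow_eq_rpow_re_of_pos hy0, Complex.norm_exp]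
      rw [Real.norm_of_nonneg (Real.exp_pos _).le, Real.norm_of_nonneg (by positivity)] at hy
      rw [Real.norm_of_nonneg (by positivity), abs_of_pos hy0]
      have e : (-((v:ℂ) * y)).re = -v * y := by simp
      rw [e]
      calc y ^ s.re * Real.exp (-v * y) ≤ y ^ s.re * (c * y ^ (-(2:ℝ) - s.re)) := by gcongr
        _ = c * (y ^ s.re * y ^ (-(2:ℝ) - s.re)) := by ring
        _ = _ := by rw [← Real.rpow_add hy0]; ring_nf
  have hF : ∀ n : ℤ, 𝓕 g n = (lamZ v n) ^ (-1 - s) * Complex.Gamma (1 + s) := by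
    intro n
    rw [Real.fourier_real_eq_integral_exp_smul, ← MeasureTheory.setIntegral_eq_integral_of_forall_compl_eq_zero (s := Set.Ioi 0)]
    · have h := lam_gamma (a := 1 + s) (r := lamZ v n) (by simp; linarith) (by rw [lamZ_re]; exact hv)
      rw [show -1 - s = -(1+s) by ring, ← h]
      refine MeasureTheory.setIntegral_congr_fun measurableSet_Ioi (fun y hy => ?_)
      rw [hpos y hy, smul_eq_mul, add_sub_cancel_left, mul_left_comm, ← Complex.exp_add]
      congr 2
      simp only [lamZ]; push_cast; ring
    · intro y hy
      rw [hneg y (by simpa using hy), smul_zero]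
  have hs1 : Summable fun m : ℕ => (lamZ v ((m:ℤ) + 1)) ^ (-1 - s) * Complex.Gamma (1 + s) :=
    (Summable.of_norm_bounded (summable_inv_sq.mul_left _) (fun m => lam_cpow_bound hs v m (abs_cast_aux m))).mul_right _
  have hs2 : Summable fun m : ℕ => (lamZ v (-((m:ℤ) + 1))) ^ (-1 - s) * Complex.Gamma (1 + s) :=
    (Summable.of_norm_bounded (summable_inv_sq.mul_left _) (fun m => lam_cpow_bound hs v m (abs_cast_aux' m))).mul_right _
  have hsF : Summable fun n : ℤ => 𝓕 g n := by
    simp_rw [hF]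
    exact Summable.of_add_one_of_neg_add_one hs1 hs2
  have hP := Real.tsum_eq_tsum_fourier_of_rpow_decay_of_summable hgc one_lt_two hdecay hsF 0
  have hR : ∑' n : ℤ, 𝓕 g n * fourier n ((0:ℝ) : UnitAddCircle) = Psi s v + Complex.Gamma (1 + s) * (v : ℂ) ^ (-(1 + s)) := by
    have : ∀ n : ℤ, 𝓕 g n * fourier n ((0:ℝ) : UnitAddCircle) = (lamZ v n) ^ (-1 - s) * Complex.Gamma (1 + s) := by
      intro n; rw [hF]; simp
    simp_rw [this]
    have h1 := tsum_of_add_one_of_neg_add_one (f := fun n : ℤ => (lamZ v n) ^ (-1 - s) * Complex.Gamma (1 + s)) hs1 hs2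
    have h2 := hs1.tsum_add hs2
    refine h1.trans ?_
    have h3 : Psi s v = ∑' m : ℕ, ((lamZ v ((m:ℤ) + 1)) ^ (-1 - s) * Complex.Gamma (1 + s) + (lamZ v (-((m:ℤ) + 1))) ^ (-1 - s) * Complex.Gamma (1 + s)) := by
      rw [Psi, ← tsum_mul_left]
      refine tsum_congr fun m => ?_
      rw [psiT]; ring
    rw [h3, h2, add_right_comm]
    congr 1
    · simp only [lamZ]
      rw [show -1 - s = -(1+s) by ring]; simp [mul_comm]
  rw [← hR, ← hP]
  have hL1 : ∀ n : ℕ, g (0 + (((n:ℤ) + 1 : ℤ) : ℝ)) = ((n : ℂ) + 1) ^ s * ((Real.exp (-(((n:ℝ) + 1) * v)) : ℝ) : ℂ) := by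
    intro n
    rw [hpos _ (by push_cast; positivity)]
    push_cast
    ring_nf
  have hL2 : ∀ n : ℕ, g (0 + ((-((n:ℤ) + 1) : ℤ) : ℝ)) = 0 := by
    intro n
    apply hneg
    push_cast
    linarith [(Nat.cast_nonneg n : (0:ℝ) ≤ n)]
  have hsl : Summable fun n : ℤ => g (0 + (n:ℝ)) := by
    simp only [zero_add]
    exact summable_of_isBigO (Real.summable_abs_int_rpow one_lt_two) (hdecay.comp_tendsto Int.tendsto_coe_cofinite)
  have hl1 : Summable fun n : ℕ => g (0 + (((n:ℤ) + 1 : ℤ) : ℝ)) :=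
    hsl.comp_injective (i := fun n : ℕ => (n:ℤ) + 1) (fun a b h => by simpa using h)
  rw [tsum_of_add_one_of_neg_add_one hl1 (by simp_rw [hL2]; exact summable_zero)]
  simp_rw [hL1, hL2]
  rw [hneg _ (by simp)]
  simp


theorem lam_sum_aux {t : ℝ} (ht : 0 < t) (ht1 : t ≤ 1) :
    Summable (fun n : ℕ => ((1 + t * n / 2) ^ 2)⁻¹) ∧ ∑' n : ℕ, ((1 + t * n / 2) ^ 2)⁻¹ ≤ 4 / t := by
  have hle : ∀ N : ℕ, ∑ n ∈ Finset.range N, ((1 + t * n / 2) ^ 2)⁻¹ ≤ 4 / t := by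
    intro N
    have h1 : ∀ n : ℕ, ((1 + t * n / 2) ^ 2)⁻¹ ≤ 4 / t * ((1 + t * n / 2)⁻¹ - (1 + t * ((n + 1 : ℕ) : ℝ) / 2)⁻¹) := by
      intro n
      have hn : (0:ℝ) ≤ n := Nat.cast_nonneg n
      have htn : 0 ≤ t * n := by positivity
      have hA : 0 < 1 + t * n / 2 := by positivity
      have hB : 0 < 1 + t * ((n + 1 : ℕ) : ℝ) / 2 := by positivity
      rw [inv_sub_inv hA.ne' hB.ne', ← mul_div_assoc, le_div_iff₀ (by positivity)]
      push_cast
      have e : 4 / t * (1 + t * ((n:ℝ) + 1) / 2 - (1 + t * n / 2)) = 2 := by field_simp; ring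
      rw [e, inv_mul_le_iff₀ (by positivity)]
      nlinarith
    calc _ ≤ ∑ n ∈ Finset.range N, 4 / t * ((1 + t * n / 2)⁻¹ - (1 + t * ((n + 1 : ℕ) : ℝ) / 2)⁻¹) :=
          Finset.sum_le_sum fun n _ => h1 n
      _ = 4 / t * ((1 + t * ((0:ℕ):ℝ) / 2)⁻¹ - (1 + t * N / 2)⁻¹) := by
          rw [← Finset.mul_sum, Finset.sum_range_sub' (fun n : ℕ => (1 + t * n / 2)⁻¹)]
      _ ≤ 4 / t * 1 := by
          gcongr
          have : 0 ≤ (1 + t * N / 2)⁻¹ := by positivity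
          simp
          positivity
      _ = 4 / t := mul_one _
  exact ⟨summable_of_sum_range_le (fun n => by positivity) hle, Real.tsum_le_of_sum_range_le (fun n => by positivity) hle⟩

noncomputable def Theta (s : ℂ) (x t : ℝ) : ℂ := ∑' n : ℕ, Psi s (t * (n + x))

theorem PsiC_nonneg (s : ℂ) : 0 ≤ PsiC s := by
  unfold PsiC
  have : 0 ≤ ∑' m : ℕ, (((m:ℝ) + 1) ^ 2)⁻¹ := tsum_nonneg fun m => by positivity
  positivity

theorem Theta_term {s : ℂ} (hs : 3 ≤ s.re) {t : ℝ} (ht : 0 < t) {x : ℝ} (hx : -(1/2) < x) (n : ℕ) :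
    ‖Psi s (t * (n + x))‖ ≤ PsiC s * ((1 + t * n / 2) ^ 2)⁻¹ := by
  refine (Psi_bound hs _).trans ?_
  have := PsiC_nonneg s
  gcongr
  rw [abs_mul, abs_of_pos ht]
  have : (n:ℝ) / 2 ≤ |(n:ℝ) + x| := by
    rcases Nat.eq_zero_or_pos n with h | h
    · simp [h]
    · have : (1:ℝ) ≤ n := by exact_mod_cast h
      refine le_trans ?_ (le_abs_self _)
      linarith
  nlinarith

theorem Theta_summable {s : ℂ} (hs : 3 ≤ s.re) {t : ℝ} (ht : 0 < t) (ht1 : t ≤ 1) {x : ℝ} (hx : -(1/2) < x) :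
    Summable (fun n : ℕ => Psi s (t * (n + x))) :=
  Summable.of_norm_bounded ((lam_sum_aux ht ht1).1.mul_left _) (Theta_term hs ht hx)

theorem Theta_bound {s : ℂ} (hs : 3 ≤ s.re) {t : ℝ} (ht : 0 < t) (ht1 : t ≤ 1) {x : ℝ} (hx : -(1/2) < x) :
    ‖Theta s x t‖ ≤ PsiC s * (4 / t) := by
  have h := tsum_of_norm_bounded ((lam_sum_aux ht ht1).1.mul_left (PsiC s)).hasSum (Theta_term hs ht hx)
  rw [tsum_mul_left] at h
  refine h.trans ?_
  have := PsiC_nonneg s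
  gcongr
  exact (lam_sum_aux ht ht1).2

theorem hasDerivAt_Theta {s : ℂ} (hs : 3 ≤ s.re) {t : ℝ} (ht : 0 < t) (ht1 : t ≤ 1) {x : ℝ} (hx : -(1/2) < x) :
    HasDerivAt (fun x => Theta s x t) (-t * Theta (s + 1) x t) x := by
  have hs1 : 3 ≤ (s + 1).re := by simp; linarith
  have h := hasDerivAt_tsum_of_isPreconnected (u := fun n : ℕ => ‖(-t:ℂ)‖ * (PsiC (s+1) * ((1 + t * n / 2) ^ 2)⁻¹))
    (t := Set.Ioi (-(1/2) : ℝ)) (g := fun n x => Psi s (t * (n + x))) (g' := fun n x => (-t:ℂ) * Psi (s+1) (t * (n + x)))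
    (y₀ := x) (y := x) (((lam_sum_aux ht ht1).1.mul_left _).mul_left _) isOpen_Ioi isPreconnected_Ioi ?_ ?_ hx
    (Theta_summable hs ht ht1 hx) hx
  · refine h.congr_deriv ?_
    rw [tsum_mul_left, Theta]
  · intro n y hy
    have h1 : HasDerivAt (fun y : ℝ => t * ((n:ℝ) + y)) t y := by
      simpa using ((hasDerivAt_id y).const_add (n:ℝ)).const_mul t
    have h2 := (hasDerivAt_Psi hs (t * ((n:ℝ) + y))).scomp y h1
    refine h2.congr_deriv ?_
    simp
  · intro n y hy
    rw [norm_mul]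
    gcongr
    exact Theta_term hs1 ht hy n

theorem Theta_shift {s : ℂ} (hs : 3 ≤ s.re) {t : ℝ} (ht : 0 < t) (ht1 : t ≤ 1) :
    Theta s 0 t - Theta s 1 t = Psi s 0 := by
  have h := (Theta_summable hs ht ht1 (x := 0) (by norm_num)).tsum_eq_zero_add
  rw [Theta, h, Theta]
  have : ∀ n : ℕ, Psi s (t * (((n+1 : ℕ):ℝ) + 0)) = Psi s (t * ((n:ℝ) + 1)) := by
    intro n; push_cast; simp
  simp_rw [this]
  simp

theorem lam_summable_exp (R : ℝ) {c : ℝ} (hc : 0 < c) :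
    Summable (fun k : ℕ => ((k:ℝ) + 1) ^ R * Real.exp (-(((k:ℝ) + 1) * c))) := by
  have h := Real.summable_pow_mul_exp_neg_nat_mul (⌈|R|⌉₊) hc
  have h2 := (summable_nat_add_iff 1).2 h
  refine Summable.of_nonneg_of_le (fun k => by positivity) (fun k => ?_) h2
  have hk : (1:ℝ) ≤ (k:ℝ) + 1 := by linarith [(Nat.cast_nonneg k : (0:ℝ) ≤ k)]
  have e : Real.exp (-c * ((k + 1 : ℕ) : ℝ)) = Real.exp (-(((k:ℝ) + 1) * c)) := by
    congr 1; push_cast; ring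
  rw [e]
  gcongr
  push_cast
  rw [← Real.rpow_natCast]
  exact Real.rpow_le_rpow_of_exponent_le hk ((le_abs_self R).trans (Nat.le_ceil _))

noncomputable def lamL (s : ℂ) (x t : ℝ) : ℂ :=
  ∑' k : ℕ, ((k : ℂ) + 1) ^ s * ((Real.exp (-(((k:ℝ) + 1) * (t * x))) : ℝ) : ℂ) /
    (1 - ((Real.exp (-(((k:ℝ) + 1) * t)) : ℝ) : ℂ))

noncomputable def lamH (s : ℂ) (x t : ℝ) : ℂ :=
  lamL s x t - Complex.Gamma (1 + s) * HurwitzZeta.hurwitzZeta (x : UnitAddCircle) (1 + s) * (t : ℂ) ^ (-(1 + s))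

theorem norm_nat_cpow (k : ℕ) (s : ℂ) : ‖((k:ℂ) + 1) ^ s‖ = ((k:ℝ) + 1) ^ s.re := by
  have : ((k:ℂ) + 1) = (((k:ℝ) + 1 : ℝ) : ℂ) := by push_cast; rfl
  rw [this, Complex.norm_cpow_eq_rpow_re_of_pos (by positivity)]

theorem lamL_eq (s : ℂ) {x t : ℝ} (hx : 0 < x) (ht : 0 < t) :
    lamL s x t = ∑' n : ℕ, ∑' k : ℕ, ((k : ℂ) + 1) ^ s * ((Real.exp (-(((k:ℝ) + 1) * (t * (n + x)))) : ℝ) : ℂ) := by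
  have hsum : Summable (Function.uncurry fun (k n : ℕ) => ((k : ℂ) + 1) ^ s * ((Real.exp (-(((k:ℝ) + 1) * (t * (n + x)))) : ℝ) : ℂ)) := by
    have h1 := lam_summable_exp s.re (c := t * x) (by positivity)
    have h2 : Summable (fun n : ℕ => Real.exp (-t) ^ n) :=
      summable_geometric_of_lt_one (Real.exp_pos _).le (by simpa using ht)
    have h3 := h1.mul_of_nonneg h2 (fun k => by simp only [Pi.zero_apply]; positivity) (fun n => by simp only [Pi.zero_apply]; positivity)
    refine Summable.of_norm_bounded h3 ?_
    rintro ⟨k, n⟩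
    simp only [Function.uncurry_apply_pair, norm_mul, norm_nat_cpow, Complex.norm_real, Real.norm_eq_abs, Real.abs_exp]
    rw [mul_assoc, ← Real.exp_nat_mul, ← Real.exp_add]
    gcongr
    have : 0 ≤ (k:ℝ) * (n * t) := by positivity
    nlinarith
  rw [hsum.tsum_comm, lamL]
  refine tsum_congr fun k => ?_
  rw [tsum_mul_left, mul_div_assoc]
  congr 1
  have hr : Real.exp (-(((k:ℝ) + 1) * t)) < 1 := by
    rw [Real.exp_lt_one_iff]
    have : 0 < ((k:ℝ) + 1) * t := by positivity
    linarith
  have hg := tsum_geometric_of_lt_one (Real.exp_pos (-(((k:ℝ) + 1) * t))).le hr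
  have e : ∀ n : ℕ, Real.exp (-(((k:ℝ) + 1) * (t * (n + x)))) = Real.exp (-(((k:ℝ) + 1) * (t * x))) * Real.exp (-(((k:ℝ) + 1) * t)) ^ n := by
    intro n
    rw [← Real.exp_nat_mul, ← Real.exp_add]; congr 1; ring
  rw [← Complex.ofReal_tsum]
  simp_rw [e]
  rw [tsum_mul_left, hg]
  push_cast
  rw [div_eq_mul_inv]

theorem lamH_eq {s : ℂ} (hs : 3 ≤ s.re) {t : ℝ} (ht : 0 < t) (ht1 : t ≤ 1) {x : ℝ} (hx : 0 < x) (hx1 : x ≤ 1) :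
    lamH s x t = Theta s x t := by
  rw [lamH, lamL_eq s hx ht]
  have hz := HurwitzZeta.hasSum_hurwitzZeta_of_one_lt_re (a := x) ⟨hx.le, hx1⟩ (s := 1 + s) (by simp; linarith)
  have hz2 := (hz.mul_left (Complex.Gamma (1 + s))).mul_right ((t : ℂ) ^ (-(1 + s)))
  have hT := (Theta_summable hs ht ht1 (x := x) (by linarith)).hasSum
  have hadd := (hT.add hz2).tsum_eq
  rw [sub_eq_iff_eq_add, Theta, ← hadd]
  refine tsum_congr fun n => ?_
  have hnx : 0 < (n:ℝ) + x := by positivity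
  rw [lam_poisson hs (by positivity)]
  congr 1
  rw [Complex.ofReal_mul, Complex.mul_cpow_ofReal_nonneg ht.le hnx.le, Complex.cpow_neg ((((n:ℝ) + x : ℝ)) : ℂ)]
  push_cast
  rw [one_div]
  ring


theorem lamL_differentiable {x t : ℝ} (hx : 0 < x) (ht : 0 < t) :
    Differentiable ℂ (fun s => lamL s x t) := by
  intro s0
  have hopen : IsOpen {s : ℂ | s.re < s0.re + 1} := isOpen_lt Complex.continuous_re continuous_const
  have hlt : 0 < 1 - Real.exp (-t) := by
    have : Real.exp (-t) < 1 := by simpa using ht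
    linarith
  have h1 := (lam_summable_exp (s0.re + 1) (c := t * x) (by positivity)).mul_right ((1 - Real.exp (-t))⁻¹)
  have h := Complex.differentiableOn_tsum_of_summable_norm (E := ℂ)
    (F := fun (k:ℕ) (s:ℂ) => ((k : ℂ) + 1) ^ s * ((Real.exp (-(((k:ℝ) + 1) * (t * x))) : ℝ) : ℂ) /
    (1 - ((Real.exp (-(((k:ℝ) + 1) * t)) : ℝ) : ℂ))) h1 (fun k => by
      have : ((k:ℂ) + 1) ≠ 0 := by exact_mod_cast Nat.succ_ne_zero k
      intro s hs
      refine DifferentiableAt.differentiableWithinAt ?_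
      exact ((differentiableAt_id.const_cpow (Or.inl this)).mul_const _).div_const _) hopen (fun k s hs => by
      have hs' : s.re < s0.re + 1 := hs
      rw [norm_div, norm_mul, norm_nat_cpow, div_eq_mul_inv]
      have e1 : ‖((Real.exp (-(((k:ℝ) + 1) * (t * x))) : ℝ) : ℂ)‖ = Real.exp (-(((k:ℝ) + 1) * (t * x))) := by
        rw [Complex.norm_real, Real.norm_eq_abs, Real.abs_exp]
      have e2 : 1 - Real.exp (-t) ≤ ‖(1 - ((Real.exp (-(((k:ℝ) + 1) * t)) : ℝ) : ℂ))‖ := by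
        have : (1 - ((Real.exp (-(((k:ℝ) + 1) * t)) : ℝ) : ℂ)) = ((1 - Real.exp (-(((k:ℝ) + 1) * t)) : ℝ) : ℂ) := by push_cast; rfl
        rw [this, Complex.norm_real, Real.norm_eq_abs]
        refine le_trans ?_ (le_abs_self _)
        have : Real.exp (-(((k:ℝ) + 1) * t)) ≤ Real.exp (-t) := by
          apply Real.exp_le_exp.2
          have : 0 ≤ (k:ℝ) * t := by positivity
          linarith
        linarith
      rw [e1]
      have e3 : ((k:ℝ) + 1) ^ s.re ≤ ((k:ℝ) + 1) ^ (s0.re + 1) :=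
        Real.rpow_le_rpow_of_exponent_le (by simp) hs'.le
      gcongr)
  exact (h.differentiableAt (hopen.mem_nhds (by simp)))

theorem lamH_differentiableAt {x t : ℝ} (hx : 0 < x) (ht : 0 < t) {s : ℂ} (hs : ∀ n : ℕ, s ≠ -(n:ℂ)) :
    DifferentiableAt ℂ (fun s => lamH s x t) s := by
  unfold lamH
  refine (lamL_differentiable hx ht s).sub ((DifferentiableAt.mul ?_ ?_).mul ?_)
  · refine (Complex.differentiableAt_Gamma (1 + s) (fun m h => ?_)).comp s ((differentiableAt_const _).add differentiableAt_id)
    refine hs (m+1) ?_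
    push_cast
    linear_combination h
  · refine (HurwitzZeta.differentiableAt_hurwitzZeta (x : UnitAddCircle) (s := 1 + s) (fun h => ?_)).comp s ((differentiableAt_const _).add differentiableAt_id)
    refine hs 0 ?_
    push_cast
    linear_combination h
  · have : (t:ℂ) ≠ 0 := by exact_mod_cast ht.ne'
    exact (((differentiableAt_const _).add differentiableAt_id).neg).const_cpow (Or.inl this)

/-- the punctured half planes -/
def lamU (m : ℕ) : Set ℂ := {s | 3 - (m:ℝ) < s.re ∧ ∀ n : ℕ, s ≠ -(n:ℂ)}

theorem lamU_open (m : ℕ) : IsOpen (lamU m) := by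
  have h1 : IsOpen {s : ℂ | 3 - (m:ℝ) < s.re} := isOpen_lt continuous_const Complex.continuous_re
  have h2 : IsClosed (Set.range (fun n : ℕ => -(n:ℂ))) := by
    have : Topology.IsClosedEmbedding (fun n : ℕ => -(n:ℂ)) :=
      (Homeomorph.neg ℂ).isClosedEmbedding.comp (Complex.isometry_ofReal.isClosedEmbedding.comp Nat.isClosedEmbedding_coe_real)
    exact this.isClosed_range
  have : lamU m = {s : ℂ | 3 - (m:ℝ) < s.re} ∩ (Set.range (fun n : ℕ => -(n:ℂ)))ᶜ := by
    ext s
    simp [lamU, eq_comm]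
  rw [this]
  exact h1.inter h2.isOpen_compl

theorem lamU_preconnected (m : ℕ) : IsPreconnected (lamU m) := by
  let φ : ℂ → ℂ := fun w => ((3 - (m:ℝ) + Real.exp w.re : ℝ) : ℂ) + (w.im : ℂ) * Complex.I
  have hre : ∀ w, (φ w).re = 3 - (m:ℝ) + Real.exp w.re := fun w => by
    simp only [φ, Complex.add_re, Complex.ofReal_re, Complex.re_ofReal_mul, Complex.I_re, mul_zero, add_zero]
  have him : ∀ w, (φ w).im = w.im := fun w => by
    simp only [φ, Complex.add_im, Complex.ofReal_im, Complex.im_ofReal_mul, Complex.I_im, mul_one, zero_add]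
  have hc : Continuous φ := by
    simp only [φ]
    have := Complex.continuous_re
    have := Complex.continuous_im
    have := Complex.continuous_ofReal
    fun_prop
  have hinj : Function.Injective φ := by
    intro a b h
    have h1 := congrArg Complex.re h
    have h2 := congrArg Complex.im h
    rw [hre, hre] at h1
    rw [him, him] at h2
    exact Complex.ext (Real.exp_injective (by linarith)) h2
  have hS : (Set.range (fun n : ℕ => -(n:ℂ))).Countable := Set.countable_range _
  have h := (Set.Countable.isConnected_compl_of_one_lt_rank (E := ℂ) (by
    rw [Complex.rank_real_complex]; norm_num) (hS.preimage_of_injOn (f := φ) hinj.injOn)).isPreconnected.image φ hc.continuousOn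
  convert h using 1
  ext s
  constructor
  · rintro ⟨h1, h2⟩
    have e : φ ⟨Real.log (s.re - (3 - m)), s.im⟩ = s := by
      apply Complex.ext
      · rw [hre]
        simp only
        rw [Real.exp_log (by linarith)]; ring
      · rw [him]
    refine ⟨_, ?_, e⟩
    simp only [Set.mem_compl_iff, Set.mem_preimage, e]
    rintro ⟨n, hn⟩
    exact h2 n hn.symm
  · rintro ⟨w, hw, rfl⟩
    refine ⟨?_, fun n hn => hw ⟨n, hn.symm⟩⟩
    rw [hre]
    have := Real.exp_pos w.re
    linarith

/-- the recursively continued theta function -/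
noncomputable def lamT (t : ℝ) : ℕ → ℂ → ℝ → ℂ
  | 0, s, x => Theta s x t
  | m + 1, s, x => riemannZeta (1 - s) / t -
      t * ((∫ z in (0:ℝ)..x, lamT t m (s + 1) z) - ∫ z in (0:ℝ)..1, ((1 - z : ℝ) : ℂ) * lamT t m (s + 1) z)

theorem Theta_continuousOn {s : ℂ} (hs : 3 ≤ s.re) {t : ℝ} (ht : 0 < t) (ht1 : t ≤ 1) :
    ContinuousOn (fun x => Theta s x t) (Set.Icc 0 1) := fun x hx =>
  (hasDerivAt_Theta hs ht ht1 (x := x) (by linarith [hx.1])).continuousAt.continuousWithinAt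

theorem Theta_rel {s : ℂ} (hs : 4 ≤ s.re) {t : ℝ} (ht : 0 < t) (ht1 : t ≤ 1) {x : ℝ} (hx : x ∈ Set.Icc (0:ℝ) 1) :
    Theta s x t = riemannZeta (1 - s) / t -
      t * ((∫ z in (0:ℝ)..x, Theta (s + 1) z t) - ∫ z in (0:ℝ)..1, ((1 - z : ℝ) : ℂ) * Theta (s + 1) z t) := by
  have hs3 : 3 ≤ s.re := by linarith
  have htc : (t:ℂ) ≠ 0 := by exact_mod_cast ht.ne'
  have hsp : 3 ≤ (s + 1).re := by simp; linarith
  have hsm : 3 ≤ (s - 1).re := by simp; linarith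
  have hc := Theta_continuousOn hsp ht ht1
  have i1 := intervalIntegral.integral_eq_sub_of_hasDerivAt (a := 0) (b := x) (f := fun x => Theta s x t)
    (f' := fun x => -t * Theta (s + 1) x t) (fun z hz => by
      rw [Set.uIcc_of_le hx.1] at hz
      exact hasDerivAt_Theta hs3 ht ht1 (by linarith [hz.1])) (by
      refine ContinuousOn.intervalIntegrable ?_
      rw [Set.uIcc_of_le hx.1]
      exact continuousOn_const.mul (hc.mono (Set.Icc_subset_Icc_right hx.2)))
  rw [intervalIntegral.integral_const_mul] at i1
  have i2 := intervalIntegral.integral_eq_sub_of_hasDerivAt (a := 0) (b := 1)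
    (f := fun z : ℝ => -(((1 - z : ℝ) : ℂ) * Theta s z t) + Theta (s - 1) z t / t)
    (f' := fun z => t * (((1 - z : ℝ) : ℂ) * Theta (s + 1) z t)) (fun z hz => by
      rw [Set.uIcc_of_le zero_le_one] at hz
      have a1 := hasDerivAt_Theta hs3 ht ht1 (x := z) (by linarith [hz.1])
      have a2 := hasDerivAt_Theta hsm ht ht1 (x := z) (by linarith [hz.1])
      have a3 : HasDerivAt (fun z : ℝ => ((1 - z : ℝ) : ℂ)) ((-1 : ℝ) : ℂ) z := by
        have := ((hasDerivAt_id z).const_sub 1).ofReal_comp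
        simpa using this
      refine ((a3.mul a1).neg.add (a2.div_const (t:ℂ))).congr_deriv ?_
      rw [sub_add_cancel]
      push_cast
      field_simp
      ring) (by
      refine ContinuousOn.intervalIntegrable ?_
      rw [Set.uIcc_of_le zero_le_one]
      refine continuousOn_const.mul (ContinuousOn.mul ?_ hc)
      exact (Complex.continuous_ofReal.comp (continuous_const.sub continuous_id)).continuousOn)
  rw [intervalIntegral.integral_const_mul] at i2
  have i3 := Theta_shift hsm ht ht1
  rw [Psi_zero hsm] at i3
  have e : -(s - 1) = 1 - s := by ring
  rw [e] at i3
  push_cast at i2 ⊢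
  simp only [sub_self, sub_zero, zero_mul, one_mul, neg_zero, zero_add] at i2
  rw [← i3]
  linear_combination -i2 - i1

theorem lamT_eq_Theta {t : ℝ} (ht : 0 < t) (ht1 : t ≤ 1) (m : ℕ) : ∀ {s : ℂ}, 4 ≤ s.re → ∀ {x : ℝ}, x ∈ Set.Icc (0:ℝ) 1 →
    lamT t m s x = Theta s x t := by
  induction m with
  | zero => intro s hs x hx; rfl
  | succ m ih =>
    intro s hs x hx
    have hsp : 4 ≤ (s + 1).re := by simp; linarith
    rw [Theta_rel hs ht ht1 hx, lamT]
    congr 3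
    · refine intervalIntegral.integral_congr (fun z hz => ?_)
      rw [Set.uIcc_of_le hx.1] at hz
      exact ih hsp ⟨hz.1, hz.2.trans hx.2⟩
    · refine intervalIntegral.integral_congr (fun z hz => ?_)
      rw [Set.uIcc_of_le zero_le_one] at hz
      rw [ih hsp hz]

theorem lamU_succ {m : ℕ} {s : ℂ} (hs : s ∈ lamU (m+1)) : s + 1 ∈ lamU m := by
  obtain ⟨h1, h2⟩ := hs
  push_cast at h1
  refine ⟨by simp; linarith, fun n hn => h2 (n+1) ?_⟩
  push_cast
  linear_combination hn


theorem PsiC_continuousAt {s : ℂ} (hs : 3 < s.re) : ContinuousAt PsiC s := by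
  unfold PsiC
  have h1 : ContinuousAt (fun s : ℂ => Complex.Gamma (1 + s)) s := by
    refine ((Complex.differentiableAt_Gamma (1 + s) (fun m h => ?_)).comp s ((differentiableAt_const _).add differentiableAt_id)).continuousAt
    have := congrArg Complex.re h
    simp at this
    linarith [(Nat.cast_nonneg m : (0:ℝ) ≤ m)]
  have h2 : Continuous (fun s : ℂ => (2 * Real.exp (π * |s.im|) * ∑' m : ℕ, (((m:ℝ)+1)^2)⁻¹)) := by
    have := Complex.continuous_im
    fun_prop
  exact h1.norm.mul h2.continuousAt

theorem lamT_props {t : ℝ} (ht : 0 < t) (ht1 : t ≤ 1) (m : ℕ) :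
    (∀ s ∈ lamU m, ContinuousOn (lamT t m s) (Set.Icc 0 1)) ∧
    (∀ s₀ ∈ lamU m, ∃ ε > 0, ∃ C : ℝ, ∀ s ∈ Metric.ball s₀ ε, ∀ x ∈ Set.Icc (0:ℝ) 1, ‖lamT t m s x‖ ≤ C) ∧
    (∀ x ∈ Set.Ioc (0:ℝ) 1, DifferentiableOn ℂ (fun s => lamT t m s x) (lamU m)) := by
  induction m with
  | zero =>
    refine ⟨fun s hs => ?_, fun s₀ hs => ?_, fun x hx => ?_⟩
    · have : 3 ≤ s.re := by have := hs.1; push_cast at this; linarith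
      exact Theta_continuousOn this ht ht1
    · have h3 : 3 < s₀.re := by have := hs.1; push_cast at this; linarith
      have h1 := (PsiC_continuousAt h3).eventually (gt_mem_nhds (lt_add_one (PsiC s₀)))
      have h2 : ∀ᶠ s : ℂ in 𝓝 s₀, 3 < s.re :=
        Complex.continuous_re.continuousAt.eventually (lt_mem_nhds h3)
      obtain ⟨ε, hε, hb⟩ := Metric.eventually_nhds_iff_ball.1 (h1.and h2)
      refine ⟨ε, hε, (PsiC s₀ + 1) * (4 / t), fun s hs x hx => ?_⟩
      obtain ⟨a, b⟩ := hb s hs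
      refine (Theta_bound b.le ht ht1 (by linarith [hx.1])).trans ?_
      gcongr
    · refine DifferentiableOn.congr (f := fun s => lamH s x t) (fun s hs => (lamH_differentiableAt hx.1 ht hs.2).differentiableWithinAt) (fun s hs => ?_)
      have : 3 ≤ s.re := by have := hs.1; push_cast at this; linarith
      exact (lamH_eq this ht ht1 hx.1 hx.2).symm
  | succ m ih =>
    obtain ⟨ihc, ihb, ihd⟩ := ih
    have hintg : ∀ s ∈ lamU (m+1), IntervalIntegrable (lamT t m (s+1)) MeasureTheory.volume 0 1 := fun s hs =>
      ContinuousOn.intervalIntegrable (by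
        rw [Set.uIcc_of_le zero_le_one]; exact ihc _ (lamU_succ hs))
    refine ⟨fun s hs => ?_, fun s₀ hs => ?_, fun x hx => ?_⟩
    · simp only [lamT]
      refine continuousOn_const.sub (continuousOn_const.mul (ContinuousOn.sub ?_ continuousOn_const))
      have := intervalIntegral.continuousOn_primitive_interval (μ := MeasureTheory.volume) (f := lamT t m (s+1)) (a := 0) (b := 1) (by
        have := (hintg s hs)
        rw [Set.uIcc_of_le zero_le_one, integrableOn_Icc_iff_integrableOn_Ioc]
        exact (intervalIntegrable_iff_integrableOn_Ioc_of_le zero_le_one).1 this)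
      rwa [Set.uIcc_of_le zero_le_one] at this
    · obtain ⟨ε, hε, C, hC⟩ := ihb _ (lamU_succ hs)
      have hz : ContinuousAt (fun s : ℂ => riemannZeta (1 - s)) s₀ := by
        refine ((differentiableAt_riemannZeta (s := 1 - s₀) (fun h => hs.2 0 ?_)).comp s₀ ((differentiableAt_const _).sub differentiableAt_id)).continuousAt
        push_cast
        linear_combination -h
      have h1 := hz.norm.eventually (gt_mem_nhds (lt_add_one ‖riemannZeta (1 - s₀)‖))
      obtain ⟨ε', hε', hb⟩ := Metric.eventually_nhds_iff_ball.1 h1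
      refine ⟨min ε ε', lt_min hε hε', (‖riemannZeta (1 - s₀)‖ + 1) / t + t * (C + C), fun s hs x hx => ?_⟩
      have hsε : s + 1 ∈ Metric.ball (s₀ + 1) ε := by
        have := Metric.ball_subset_ball (min_le_left ε ε') hs
        simpa using this
      have hb2 := hb s (Metric.ball_subset_ball (min_le_right ε ε') hs)
      have hC2 := hC _ hsε
      have hC0 : 0 ≤ C := (norm_nonneg _).trans (hC2 0 ⟨le_rfl, zero_le_one⟩)
      have j1 : ‖∫ z in (0:ℝ)..x, lamT t m (s + 1) z‖ ≤ C := by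
        refine (intervalIntegral.norm_integral_le_of_norm_le_const (C := C) (fun z hz => ?_)).trans ?_
        · rw [Set.uIoc_of_le hx.1] at hz
          exact hC2 z ⟨hz.1.le, hz.2.trans hx.2⟩
        · rw [sub_zero, abs_of_nonneg hx.1]
          nlinarith [hx.2]
      have j2 : ‖∫ z in (0:ℝ)..1, ((1 - z : ℝ) : ℂ) * lamT t m (s + 1) z‖ ≤ C := by
        refine (intervalIntegral.norm_integral_le_of_norm_le_const (C := C) (fun z hz => ?_)).trans ?_
        · rw [Set.uIoc_of_le zero_le_one] at hz
          rw [norm_mul, Complex.norm_real, Real.norm_eq_abs, abs_of_nonneg (by linarith [hz.2])]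
          have := hC2 z ⟨hz.1.le, hz.2⟩
          have := norm_nonneg (lamT t m (s + 1) z)
          nlinarith [hz.1, hz.2]
        · simp
      simp only [lamT]
      refine (norm_sub_le _ _).trans (add_le_add ?_ ?_)
      · rw [norm_div, Complex.norm_real, Real.norm_eq_abs, abs_of_pos ht]
        gcongr
      · rw [norm_mul, Complex.norm_real, Real.norm_eq_abs, abs_of_pos ht]
        gcongr
        exact (norm_sub_le _ _).trans (add_le_add j1 j2)
    · have key : ∀ (w : ℝ → ℂ) (_ : Continuous w) (_ : ∀ z ∈ Set.Icc (0:ℝ) 1, ‖w z‖ ≤ 1), ∀ x ∈ Set.Ioc (0:ℝ) 1,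
          DifferentiableOn ℂ (fun s => ∫ z in (0:ℝ)..x, w z * lamT t m (s + 1) z) (lamU (m+1)) := by
        intro w hw hw1 x hx
        simp only [intervalIntegral.integral_of_le hx.1.le]
        refine lam_param (lamU_open _) (fun s z => w z * lamT t m (s + 1) z) (fun s hs => ?_) ?_ (fun s₀ hs => ?_)
        · refine ContinuousOn.aestronglyMeasurable ?_ measurableSet_Ioc
          exact hw.continuousOn.mul ((ihc _ (lamU_succ hs)).mono (fun z hz => ⟨hz.1.le, hz.2.trans hx.2⟩))
        · refine (MeasureTheory.ae_restrict_iff' measurableSet_Ioc).2 (Eventually.of_forall fun z hz => ?_)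
          refine (differentiableOn_const _).mul ?_
          exact (ihd z ⟨hz.1, hz.2.trans hx.2⟩).comp (differentiableOn_id.add (differentiableOn_const 1)) (fun s hs => lamU_succ hs)
        · obtain ⟨ε, hε, C, hC⟩ := ihb _ (lamU_succ hs)
          refine ⟨ε, hε, fun _ => C, MeasureTheory.integrable_const _, ?_⟩
          refine (MeasureTheory.ae_restrict_iff' measurableSet_Ioc).2 (Eventually.of_forall fun z hz s hs => ?_)
          have hz' : z ∈ Set.Icc (0:ℝ) 1 := ⟨hz.1.le, hz.2.trans hx.2⟩
          have h1 := hC (s+1) (by simpa using hs) z hz'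
          have h2 := hw1 z hz'
          rw [norm_mul]
          have := norm_nonneg (w z)
          have := norm_nonneg (lamT t m (s + 1) z)
          nlinarith
      have k1 := key (fun _ => 1) continuous_const (by simp) x hx
      have k2 := key (fun z => ((1 - z : ℝ) : ℂ)) (Complex.continuous_ofReal.comp (continuous_const.sub continuous_id)) (fun z hz => by
        rw [Complex.norm_real, Real.norm_eq_abs, abs_of_nonneg (by linarith [hz.2])]; linarith [hz.1]) 1 ⟨one_pos, le_rfl⟩
      simp only [one_mul] at k1
      simp only [lamT]
      refine DifferentiableOn.sub ?_ ((differentiableOn_const _).mul (k1.sub k2))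
      intro s hs
      refine DifferentiableAt.differentiableWithinAt (DifferentiableAt.div_const ?_ _)
      refine ((differentiableAt_riemannZeta (s := 1 - s) (fun h => hs.2 0 ?_)).comp s ((differentiableAt_const _).sub differentiableAt_id))
      push_cast
      linear_combination -h

theorem lamH_eq_lamT {t : ℝ} (ht : 0 < t) (ht1 : t ≤ 1) {x : ℝ} (hx : x ∈ Set.Ioc (0:ℝ) 1) (m : ℕ) {s : ℂ} (hs : s ∈ lamU m) :
    lamH s x t = lamT t m s x := by
  have h1 : AnalyticOnNhd ℂ (fun s => lamH s x t) (lamU m) :=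
    DifferentiableOn.analyticOnNhd (fun s hs => (lamH_differentiableAt hx.1 ht hs.2).differentiableWithinAt) (lamU_open m)
  have h2 : AnalyticOnNhd ℂ (fun s => lamT t m s x) (lamU m) :=
    ((lamT_props ht ht1 m).2.2 x hx).analyticOnNhd (lamU_open m)
  have hm : (5:ℂ) ∈ lamU m := by
    refine ⟨?_, fun n hn => ?_⟩
    · simp
      linarith [(Nat.cast_nonneg m : (0:ℝ) ≤ m)]
    · have := congrArg Complex.re hn
      simp at this
      linarith [(Nat.cast_nonneg n : (0:ℝ) ≤ n)]
  refine h1.eqOn_of_preconnected_of_eventuallyEq h2 (lamU_preconnected m) hm ?_ hs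
  have h5 : ∀ᶠ s : ℂ in 𝓝 5, 4 < s.re :=
    Complex.continuous_re.continuousAt.eventually (lt_mem_nhds (by norm_num))
  filter_upwards [h5] with s hs
  rw [lamT_eq_Theta ht ht1 m hs.le ⟨hx.1.le, hx.2⟩, lamH_eq (by linarith) ht ht1 hx.1 hx.2]

theorem lam_bernoulli (j : ℕ) (x : ℝ) :
    (∫ z in (0:ℝ)..x, (bernoulliFun j z : ℂ)) - ∫ z in (0:ℝ)..1, ((1 - z : ℝ) : ℂ) * (bernoulliFun j z : ℂ)
      = (bernoulliFun (j+1) x : ℂ) / (j + 1) := by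
  have hj1 : ((j:ℝ) + 1) ≠ 0 := by positivity
  have hj2 : ((j:ℝ) + 2) ≠ 0 := by positivity
  have d1 : ∀ z : ℝ, HasDerivAt (fun z => bernoulliFun (j+1) z / (j+1)) (bernoulliFun j z) z := fun z => by
    refine ((hasDerivAt_bernoulliFun (j+1) z).div_const ((j:ℝ)+1)).congr_deriv ?_
    push_cast
    field_simp
  have d2 : ∀ z : ℝ, HasDerivAt (fun z => bernoulliFun (j+2) z / ((j+1)*(j+2))) (bernoulliFun (j+1) z / (j+1)) z := fun z => by
    refine ((hasDerivAt_bernoulliFun (j+2) z).div_const (((j:ℝ)+1)*(j+2))).congr_deriv ?_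
    push_cast
    field_simp
  have i1 : ∫ z in (0:ℝ)..x, bernoulliFun j z = bernoulliFun (j+1) x / (j+1) - bernoulliFun (j+1) 0 / (j+1) :=
    intervalIntegral.integral_eq_sub_of_hasDerivAt (fun z _ => d1 z) ((continuous_bernoulliFun j).intervalIntegrable _ _)
  have i2 : ∫ z in (0:ℝ)..1, (1 - z) * bernoulliFun j z =
      ((1 - 1) * (bernoulliFun (j+1) 1 / (j+1)) + bernoulliFun (j+2) 1 / ((j+1)*(j+2))) -
      ((1 - 0) * (bernoulliFun (j+1) 0 / (j+1)) + bernoulliFun (j+2) 0 / ((j+1)*(j+2))) :=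
    intervalIntegral.integral_eq_sub_of_hasDerivAt (f := fun z => (1 - z) * (bernoulliFun (j+1) z / (j+1)) + bernoulliFun (j+2) z / ((j+1)*(j+2))) (fun z _ => by
      refine ((((hasDerivAt_id z).const_sub 1).mul (d1 z)).add (d2 z)).congr_deriv ?_
      simp only [id]
      ring) (((continuous_const.sub continuous_id).mul (continuous_bernoulliFun j)).intervalIntegrable _ _)
  rw [bernoulliFun_endpoints_eq_of_ne_one (show j + 2 ≠ 1 by omega)] at i2
  have c1 : (∫ z in (0:ℝ)..x, (bernoulliFun j z : ℂ)) = ((∫ z in (0:ℝ)..x, bernoulliFun j z : ℝ) : ℂ) :=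
    intervalIntegral.integral_ofReal
  have c2 : (∫ z in (0:ℝ)..1, ((1 - z : ℝ) : ℂ) * (bernoulliFun j z : ℂ)) = ((∫ z in (0:ℝ)..1, (1 - z) * bernoulliFun j z : ℝ) : ℂ) := by
    rw [← intervalIntegral.integral_ofReal]
    push_cast
    rfl
  rw [c1, c2, i1, i2]
  push_cast
  ring


/-- the partial sums of the asymptotic expansion -/
noncomputable def lamS (M : ℕ) (s : ℂ) (x t : ℝ) : ℂ :=
  ∑ j ∈ Finset.range M, riemannZeta (1 - s - (j:ℂ)) / (Nat.factorial j : ℂ) * (bernoulliFun j x : ℂ) * (-(t:ℂ)) ^ j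

theorem lamS_continuous (M : ℕ) (s : ℂ) (t : ℝ) : Continuous (fun x => lamS M s x t) := by
  unfold lamS
  refine continuous_finsetSum _ (fun j _ => ?_)
  exact (continuous_const.mul (Complex.continuous_ofReal.comp (continuous_bernoulliFun j))).mul continuous_const

theorem lamS_rec (M : ℕ) (s : ℂ) (x t : ℝ) :
    lamS (M+1) s x t = riemannZeta (1 - s) -
      t * ((∫ z in (0:ℝ)..x, lamS M (s+1) z t) - ∫ z in (0:ℝ)..1, ((1 - z : ℝ) : ℂ) * lamS M (s+1) z t) := by
  have cb : ∀ j, Continuous (fun z => (bernoulliFun j z : ℂ)) := fun j =>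
    Complex.continuous_ofReal.comp (continuous_bernoulliFun j)
  have cl : Continuous (fun z : ℝ => ((1 - z : ℝ) : ℂ)) :=
    Complex.continuous_ofReal.comp (continuous_const.sub continuous_id)
  have e1 : ∫ z in (0:ℝ)..x, lamS M (s+1) z t = ∑ j ∈ Finset.range M,
      (riemannZeta (1 - (s+1) - (j:ℂ)) / (Nat.factorial j : ℂ) * (-(t:ℂ)) ^ j) * ∫ z in (0:ℝ)..x, (bernoulliFun j z : ℂ) := by
    have : ∀ z, lamS M (s+1) z t = ∑ j ∈ Finset.range M,
      (riemannZeta (1 - (s+1) - (j:ℂ)) / (Nat.factorial j : ℂ) * (-(t:ℂ)) ^ j) * (bernoulliFun j z : ℂ) := fun z =>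
      Finset.sum_congr rfl (fun j _ => by ring)
    simp only [this]
    refine (intervalIntegral.integral_finsetSum (fun j _ => Continuous.intervalIntegrable (continuous_const.mul (cb j)) _ _)).trans ?_
    exact Finset.sum_congr rfl (fun j _ => intervalIntegral.integral_const_mul _ _)
  have e2 : ∫ z in (0:ℝ)..1, ((1 - z : ℝ) : ℂ) * lamS M (s+1) z t = ∑ j ∈ Finset.range M,
      (riemannZeta (1 - (s+1) - (j:ℂ)) / (Nat.factorial j : ℂ) * (-(t:ℂ)) ^ j) * ∫ z in (0:ℝ)..1, ((1 - z : ℝ) : ℂ) * (bernoulliFun j z : ℂ) := by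
    have : ∀ z : ℝ, ((1 - z : ℝ) : ℂ) * lamS M (s+1) z t = ∑ j ∈ Finset.range M,
      (riemannZeta (1 - (s+1) - (j:ℂ)) / (Nat.factorial j : ℂ) * (-(t:ℂ)) ^ j) * (((1 - z : ℝ) : ℂ) * (bernoulliFun j z : ℂ)) := fun z => by
      rw [lamS, Finset.mul_sum]
      exact Finset.sum_congr rfl (fun j _ => by ring)
    simp only [this]
    refine (intervalIntegral.integral_finsetSum (fun j _ => Continuous.intervalIntegrable (continuous_const.mul (cl.mul (cb j))) _ _)).trans ?_
    exact Finset.sum_congr rfl (fun j _ => intervalIntegral.integral_const_mul _ _)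
  rw [e1, e2, ← Finset.sum_sub_distrib, lamS, Finset.sum_range_succ', Finset.mul_sum]
  have z0 : riemannZeta (1 - s - ((0:ℕ):ℂ)) / (Nat.factorial 0 : ℂ) * (bernoulliFun 0 x : ℂ) * (-(t:ℂ)) ^ 0 = riemannZeta (1 - s) := by
    simp [bernoulliFun_zero]
  rw [z0, add_comm, sub_eq_add_neg (riemannZeta (1 - s)), ← Finset.sum_neg_distrib]
  congr 1
  refine Finset.sum_congr rfl (fun j _ => ?_)
  rw [← mul_sub, lam_bernoulli, Nat.factorial_succ]
  have : 1 - s - ((j+1 : ℕ) : ℂ) = 1 - (s + 1) - j := by push_cast; ring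
  rw [this]
  have hj : ((j:ℂ) + 1) ≠ 0 := by exact_mod_cast Nat.succ_ne_zero j
  have hf : (Nat.factorial j : ℂ) ≠ 0 := by exact_mod_cast Nat.factorial_ne_zero j
  push_cast
  field_simp
  ring

theorem lamT_asymp (M : ℕ) : ∀ s ∈ lamU M, ∃ C : ℝ, ∀ t : ℝ, 0 < t → t ≤ 1 → ∀ x ∈ Set.Icc (0:ℝ) 1,
    ‖t * lamT t M s x - lamS M s x t‖ ≤ C * t ^ M := by
  induction M with
  | zero =>
    intro s hs
    have : 3 ≤ s.re := by have := hs.1; push_cast at this; linarith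
    refine ⟨PsiC s * 4, fun t ht ht1 x hx => ?_⟩
    have h := Theta_bound this ht ht1 (x := x) (by linarith [hx.1])
    simp only [lamT, lamS, Finset.range_zero, Finset.sum_empty, sub_zero, pow_zero, mul_one]
    rw [norm_mul, Complex.norm_real, Real.norm_eq_abs, abs_of_pos ht]
    calc t * ‖Theta s x t‖ ≤ t * (PsiC s * (4 / t)) := by gcongr
      _ = PsiC s * 4 := by field_simp
  | succ M ih =>
    intro s hs
    obtain ⟨C, hC⟩ := ih (s+1) (lamU_succ hs)
    refine ⟨C + C, fun t ht ht1 x hx => ?_⟩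
    have hC2 := hC t ht ht1
    have hC0 : 0 ≤ C * t ^ M := (norm_nonneg _).trans (hC2 0 ⟨le_rfl, zero_le_one⟩)
    have htc : (t:ℂ) ≠ 0 := by exact_mod_cast ht.ne'
    have cT := (lamT_props ht ht1 M).1 _ (lamU_succ hs)
    have cS := (lamS_continuous M (s+1) t)
    have cl : Continuous (fun z : ℝ => ((1 - z : ℝ) : ℂ)) :=
      Complex.continuous_ofReal.comp (continuous_const.sub continuous_id)
    have hx0 : Set.uIcc 0 x ⊆ Set.Icc 0 1 := by
      rw [Set.uIcc_of_le hx.1]; exact Set.Icc_subset_Icc_right hx.2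
    have h01 : Set.uIcc (0:ℝ) 1 ⊆ Set.Icc 0 1 := by
      rw [Set.uIcc_of_le zero_le_one]
    have f1 : (∫ z in (0:ℝ)..x, (t * lamT t M (s+1) z - lamS M (s+1) z t)) =
        t * (∫ z in (0:ℝ)..x, lamT t M (s+1) z) - ∫ z in (0:ℝ)..x, lamS M (s+1) z t := by
      rw [intervalIntegral.integral_sub, intervalIntegral.integral_const_mul]
      · exact (continuousOn_const.mul (cT.mono hx0)).intervalIntegrable
      · exact cS.intervalIntegrable _ _
    have f2 : (∫ z in (0:ℝ)..1, ((1 - z : ℝ) : ℂ) * (t * lamT t M (s+1) z - lamS M (s+1) z t)) =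
        t * (∫ z in (0:ℝ)..1, ((1 - z : ℝ) : ℂ) * lamT t M (s+1) z) - ∫ z in (0:ℝ)..1, ((1 - z : ℝ) : ℂ) * lamS M (s+1) z t := by
      rw [← intervalIntegral.integral_const_mul, ← intervalIntegral.integral_sub]
      · congr 1
        ext z
        ring
      · exact (continuousOn_const.mul (cl.continuousOn.mul (cT.mono h01))).intervalIntegrable
      · exact (cl.mul cS).intervalIntegrable _ _
    have j1 : ‖∫ z in (0:ℝ)..x, (t * lamT t M (s+1) z - lamS M (s+1) z t)‖ ≤ C * t ^ M := by
      refine (intervalIntegral.norm_integral_le_of_norm_le_const (C := C * t ^ M) (fun z hz => ?_)).trans ?_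
      · rw [Set.uIoc_of_le hx.1] at hz
        exact hC2 z ⟨hz.1.le, hz.2.trans hx.2⟩
      · rw [sub_zero, abs_of_nonneg hx.1]
        nlinarith [hx.2]
    have j2 : ‖∫ z in (0:ℝ)..1, ((1 - z : ℝ) : ℂ) * (t * lamT t M (s+1) z - lamS M (s+1) z t)‖ ≤ C * t ^ M := by
      refine (intervalIntegral.norm_integral_le_of_norm_le_const (C := C * t ^ M) (fun z hz => ?_)).trans ?_
      · rw [Set.uIoc_of_le zero_le_one] at hz
        rw [norm_mul, Complex.norm_real, Real.norm_eq_abs, abs_of_nonneg (by linarith [hz.2])]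
        have := hC2 z ⟨hz.1.le, hz.2⟩
        have := norm_nonneg (t * lamT t M (s+1) z - lamS M (s+1) z t)
        nlinarith [hz.1, hz.2]
      · simp
    have main : t * lamT t (M+1) s x - lamS (M+1) s x t =
        -(t * ((∫ z in (0:ℝ)..x, (t * lamT t M (s+1) z - lamS M (s+1) z t)) -
          ∫ z in (0:ℝ)..1, ((1 - z : ℝ) : ℂ) * (t * lamT t M (s+1) z - lamS M (s+1) z t))) := by
      rw [f1, f2, lamS_rec, lamT, mul_sub, mul_div_cancel₀ _ htc]
      ring
    rw [main, norm_neg, norm_mul, Complex.norm_real, Real.norm_eq_abs, abs_of_pos ht]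
    calc _ ≤ t * (C * t ^ M + C * t ^ M) := by
          gcongr
          exact (norm_sub_le _ _).trans (add_le_add j1 j2)
      _ = _ := by ring

theorem lamS_drop (N : ℕ) (s : ℂ) (x : ℝ) (d : ℕ) : ∃ C : ℝ, ∀ t : ℝ, 0 < t → t ≤ 1 →
    ‖lamS (N + d) s x t - lamS N s x t‖ ≤ C * t ^ N := by
  induction d with
  | zero => exact ⟨0, fun t ht ht1 => by simp⟩
  | succ d ih =>
    obtain ⟨C, hC⟩ := ih
    refine ⟨C + ‖riemannZeta (1 - s - ((N+d:ℕ):ℂ)) / (Nat.factorial (N+d) : ℂ) * (bernoulliFun (N+d) x : ℂ)‖, fun t ht ht1 => ?_⟩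
    have : lamS (N + (d+1)) s x t - lamS N s x t = (lamS (N + d) s x t - lamS N s x t) +
      riemannZeta (1 - s - ((N+d:ℕ):ℂ)) / (Nat.factorial (N+d) : ℂ) * (bernoulliFun (N+d) x : ℂ) * (-(t:ℂ)) ^ (N+d) := by
      rw [← add_assoc, lamS, Finset.sum_range_succ, ← lamS]
      ring
    rw [this, add_mul]
    refine (norm_add_le _ _).trans (add_le_add (hC t ht ht1) ?_)
    rw [norm_mul, norm_pow, norm_neg, Complex.norm_real, Real.norm_eq_abs, abs_of_pos ht]
    gcongr ?_ * ?_
    exact pow_le_pow_of_le_one ht.le ht1 (by omega)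

theorem lamH_asymp {s : ℂ} (hs : ∀ n : ℕ, s ≠ -(n : ℂ)) {x : ℝ} (hx : x ∈ Set.Ioc (0:ℝ) 1) (N : ℕ) :
    ∃ C : ℝ, ∀ t : ℝ, 0 < t → t ≤ 1 → ‖t * lamH s x t - lamS N s x t‖ ≤ C * t ^ N := by
  obtain ⟨d, hd⟩ := exists_nat_gt (3 - s.re)
  have hU : s ∈ lamU (N + d) := ⟨by
    push_cast
    linarith [(Nat.cast_nonneg N : (0:ℝ) ≤ N)], hs⟩
  obtain ⟨C₁, h1⟩ := lamT_asymp (N + d) s hU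
  obtain ⟨C₂, h2⟩ := lamS_drop N s x d
  refine ⟨|C₁| + C₂, fun t ht ht1 => ?_⟩
  have a1 := h1 t ht ht1 x ⟨hx.1.le, hx.2⟩
  rw [← lamH_eq_lamT ht ht1 hx _ hU] at a1
  have e : t * lamH s x t - lamS N s x t = (t * lamH s x t - lamS (N+d) s x t) + (lamS (N+d) s x t - lamS N s x t) := by ring
  rw [e, add_mul]
  refine (norm_add_le _ _).trans (add_le_add (a1.trans ?_) (h2 t ht ht1))
  have : t ^ (N+d) ≤ t ^ N := pow_le_pow_of_le_one ht.le ht1 (by omega)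
  calc C₁ * t ^ (N+d) ≤ |C₁| * t ^ (N+d) := by gcongr; exact le_abs_self _
    _ ≤ _ := by gcongr


theorem lambert_asymptotic (s : ℂ) (hs : ∀ n : ℕ, s ≠ -(n : ℂ))
    (x : ℝ) (hx0 : 0 < x) (hx1 : x ≤ 1) (N : ℕ) :
    (fun q : ℝ =>
        (∑' k : ℕ, ((k : ℂ) + 1) ^ s * ((q ^ (((k : ℝ) + 1) * x) : ℝ) : ℂ) /
            (1 - ((q ^ (k + 1) : ℝ) : ℂ)))
        - (Complex.Gamma (1 + s) * HurwitzZeta.hurwitzZeta (x : UnitAddCircle) (1 + s) *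
              ((Real.log (1 / q) : ℂ)) ^ (-(1 + s))
            - ∑ k ∈ Finset.range (N + 1),
                riemannZeta (1 - s - (k : ℂ)) / (Nat.factorial k : ℂ) *
                  ((Polynomial.aeval x (Polynomial.bernoulli k) : ℝ) : ℂ) *
                  ((Real.log q : ℂ)) ^ ((k : ℤ) - 1)))
      =O[𝓝[Set.Ioo (0 : ℝ) 1] 1] fun q : ℝ => (Real.log (1 / q)) ^ N := by
  obtain ⟨C, hC⟩ := lamH_asymp hs (x := x) ⟨hx0, hx1⟩ (N + 1)
  refine IsBigO.of_bound C ?_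
  have hmem : ∀ᶠ q : ℝ in 𝓝[Set.Ioo (0 : ℝ) 1] 1, q ∈ Set.Ioo (0:ℝ) 1 := self_mem_nhdsWithin
  have hnear : ∀ᶠ q : ℝ in 𝓝[Set.Ioo (0 : ℝ) 1] 1, Real.exp (-1) < q :=
    (lt_mem_nhds (by simp)).filter_mono nhdsWithin_le_nhds
  filter_upwards [hmem, hnear] with q hq hq1
  have hlog : Real.log (1 / q) = -Real.log q := by rw [one_div, Real.log_inv]
  obtain ⟨t, ht⟩ : ∃ t, t = Real.log (1 / q) := ⟨_, rfl⟩
  have htq : Real.log q = -t := by rw [ht, hlog, neg_neg]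
  have ht0 : 0 < t := by
    rw [ht, hlog]; linarith [Real.log_neg hq.1 hq.2]
  have ht1 : t ≤ 1 := by
    have := (Real.lt_log_iff_exp_lt hq.1).2 hq1
    rw [ht, hlog]; linarith
  have htc : (t:ℂ) ≠ 0 := by exact_mod_cast ht0.ne'
  have hqe : q = Real.exp (-t) := by rw [← htq, Real.exp_log hq.1]
  have hL : (∑' k : ℕ, ((k : ℂ) + 1) ^ s * ((q ^ (((k : ℝ) + 1) * x) : ℝ) : ℂ) /
            (1 - ((q ^ (k + 1) : ℝ) : ℂ))) = lamL s x t := by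
    unfold lamL
    refine tsum_congr (fun k => ?_)
    have e1 : q ^ (((k : ℝ) + 1) * x) = Real.exp (-(((k:ℝ) + 1) * (t * x))) := by
      rw [hqe, ← Real.exp_mul]; congr 1; ring
    have e2 : q ^ (k + 1) = Real.exp (-(((k:ℝ) + 1) * t)) := by
      rw [hqe, ← Real.exp_nat_mul]; congr 1; push_cast; ring
    rw [e1, e2]
  have hS : (t:ℂ) * ∑ k ∈ Finset.range (N + 1),
                riemannZeta (1 - s - (k : ℂ)) / (Nat.factorial k : ℂ) *
                  ((Polynomial.aeval x (Polynomial.bernoulli k) : ℝ) : ℂ) *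
                  ((Real.log q : ℂ)) ^ ((k : ℤ) - 1) = - lamS (N+1) s x t := by
    rw [lamS, Finset.mul_sum, ← Finset.sum_neg_distrib]
    refine Finset.sum_congr rfl (fun k _ => ?_)
    have hb : (Polynomial.aeval x (Polynomial.bernoulli k) : ℝ) = bernoulliFun k x := by
      rw [bernoulliFun, Polynomial.eval_map_algebraMap]
    have hn : (-(t:ℂ)) ≠ 0 := neg_ne_zero.2 htc
    rw [hb, htq, Complex.ofReal_neg, zpow_sub_one₀ hn, zpow_natCast]
    field_simp
  rw [hL, ← ht, Real.norm_eq_abs, abs_of_pos (pow_pos ht0 N)]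
  have h := hC t ht0 ht1
  have hfin : (t:ℂ) * (lamL s x t - (Complex.Gamma (1 + s) * HurwitzZeta.hurwitzZeta (x : UnitAddCircle) (1 + s) *
              (t : ℂ) ^ (-(1 + s))
            - ∑ k ∈ Finset.range (N + 1),
                riemannZeta (1 - s - (k : ℂ)) / (Nat.factorial k : ℂ) *
                  ((Polynomial.aeval x (Polynomial.bernoulli k) : ℝ) : ℂ) *
                  ((Real.log q : ℂ)) ^ ((k : ℤ) - 1))) = t * lamH s x t - lamS (N+1) s x t := by
    rw [lamH]
    linear_combination hS
  rw [← hfin, norm_mul, Complex.norm_real, Real.norm_eq_abs, abs_of_pos ht0] at h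
  refine le_of_mul_le_mul_left (h.trans (le_of_eq ?_)) ht0
  ring
end

section
/- Fix x ∈ ℝ with 0 < x ≤ 1 and N ∈ ℕ with N ≥ 1. Then, as q → 1⁻ (with q ∈ (0,1)), 𝓛_q(0,x) = (ψ(x) + log log(1/q))/log q − ∑_{k=1}^{N} (ζ(1−k)/k!)·B_k(x)·(log q)^(k−1) + O((log(1/q))^N). -/
open Filter Topology Asymptotics Finset Real

namespace LambertAux

lemma analytic_dslope {f : ℝ → ℝ} (hf : ∀ u, AnalyticAt ℝ f u) (u : ℝ) :
    AnalyticAt ℝ (dslope f 0) u := by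
  by_cases hu : u = 0
  · subst hu
    obtain ⟨p, hp⟩ := hf 0
    exact ⟨_, hp.has_fpower_series_dslope_fslope⟩
  · have h1 : AnalyticAt ℝ (fun v : ℝ => v⁻¹ * (f v - f 0)) u :=
      (analyticAt_id.inv hu).mul ((hf u).sub analyticAt_const)
    refine h1.congr ?_
    filter_upwards [isOpen_ne.mem_nhds hu] with v hv
    rw [dslope_of_ne _ hv, slope_def_field]
    simp [div_eq_inv_mul]

/-- `(e^u - 1)/u`. -/
noncomputable def E (u : ℝ) : ℝ := dslope Real.exp 0 u

lemma E_of_ne {u : ℝ} (hu : u ≠ 0) : E u = (Real.exp u - 1) / u := by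
  rw [E, dslope_of_ne _ hu, slope_def_field]; simp

lemma E_zero : E 0 = 1 := by simp [E]

lemma E_analytic (u : ℝ) : AnalyticAt ℝ E u :=
  analytic_dslope (f := Real.exp) (fun u => by fun_prop) u

lemma E_pos (u : ℝ) : 0 < E u := by
  rcases lt_trichotomy u 0 with h | h | h
  · rw [E_of_ne h.ne]
    exact div_pos_of_neg_of_neg (by simpa using h) h
  · rw [h, E_zero]; norm_num
  · rw [E_of_ne h.ne']
    exact div_pos (by have := Real.one_lt_exp_iff.2 h; linarith) h

/-- `1/(e^u-1) - 1/u`, extended analytically. -/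
noncomputable def H (u : ℝ) : ℝ := dslope (fun v => (E v)⁻¹) 0 u

lemma H_analytic (u : ℝ) : AnalyticAt ℝ H u :=
  analytic_dslope (f := fun v => (E v)⁻¹) (fun u => (E_analytic u).inv (E_pos u).ne') u

lemma H_contDiff {n : WithTop ℕ∞} : ContDiff ℝ n H :=
  contDiff_iff_contDiffAt.2 fun u => (H_analytic u).contDiffAt

lemma H_of_ne {u : ℝ} (hu : u ≠ 0) : H u = 1 / (Real.exp u - 1) - 1 / u := by
  rw [H, dslope_of_ne _ hu, slope_def_field]
  simp only [E_zero, E_of_ne hu]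
  have : Real.exp u - 1 ≠ 0 := by
    rw [sub_ne_zero]; simpa using hu
  field_simp
  simp
  ring

lemma H_key (u : ℝ) : (1 + u * H u) * (Real.exp u - 1) = u := by
  by_cases hu : u = 0
  · simp [hu]
  · rw [H_of_ne hu]
    have : Real.exp u - 1 ≠ 0 := by
      rw [sub_ne_zero]; simpa using hu
    field_simp
    ring

lemma iteratedDeriv_mul_id (f : ℝ → ℝ) (hf : ContDiff ℝ ⊤ f) (n : ℕ) :
    iteratedDeriv (n+1) (fun u => u * f u) 0 = (n + 1) * iteratedDeriv n f 0 := by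
  rw [iteratedDeriv_fun_mul contDiffAt_fun_id (hf.of_le le_top).contDiffAt]
  rw [Finset.sum_eq_single 1]
  · simp [iteratedDeriv_one]
  · intro k _ hk
    rcases k with _ | _ | k
    · simp
    · exact absurd rfl hk
    · have : iteratedDeriv (k+1+1) (fun u : ℝ => u) = fun _ => 0 := by
        rw [iteratedDeriv_succ']
        funext z
        simp [iteratedDeriv_const]
      simp [this]
  · simp

lemma H_deriv_zero (n : ℕ) :
    iteratedDeriv n H 0 = (bernoulli (n+1) : ℝ) / (n + 1) := by
  set A : ℝ → ℝ := fun u => 1 + u * H u with hA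
  have hAc : ContDiff ℝ ⊤ A := by
    have := H_contDiff (n := ⊤); fun_prop
  have hrec : ∀ n : ℕ, ∑ k ∈ range (n+1), ((n+1).choose k : ℝ) * iteratedDeriv k A 0
      = if n = 0 then 1 else 0 := by
    intro n
    have h1 : (fun u => A u * (Real.exp u - 1)) = fun u => u := funext H_key
    have h2 := congrArg (fun f => iteratedDeriv (n+1) f 0) h1
    have hE : ContDiff ℝ ⊤ (fun u => Real.exp u - 1) := by fun_prop
    rw [iteratedDeriv_fun_mul (hAc.of_le le_top).contDiffAt (hE.of_le le_top).contDiffAt,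
      Finset.sum_range_succ] at h2
    simp only [Nat.sub_self, iteratedDeriv_zero, Real.exp_zero, sub_self, mul_zero, add_zero] at h2
    have h3 : iteratedDeriv (n+1) (fun u : ℝ => u) 0 = if n = 0 then 1 else 0 := by
      rw [iteratedDeriv_succ']
      simp [iteratedDeriv_const]
    rw [h3] at h2
    rw [← h2]
    refine Finset.sum_congr rfl fun k hk => ?_
    have hk' : k < n + 1 := Finset.mem_range.1 hk
    obtain ⟨j, hj⟩ : ∃ j, n + 1 - k = j + 1 := ⟨n - k, by omega⟩
    rw [hj]
    have : iteratedDeriv (j+1) (fun u => Real.exp u - 1) 0 = 1 := by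
      rw [iteratedDeriv_succ']
      have : deriv (fun u => Real.exp u - 1) = Real.exp := by
        funext u; simp
      rw [this, iteratedDeriv_eq_iterate, Real.iter_deriv_exp]; simp
    rw [this, mul_one]
  have hB : ∀ n : ℕ, iteratedDeriv n A 0 = (bernoulli n : ℝ) := by
    intro n
    induction n using Nat.strong_induction_on with
    | _ n ih =>
      have h1 := hrec n
      have h2 := congrArg (fun r : ℚ => (r : ℝ)) (sum_bernoulli (n+1))
      simp only [Rat.cast_sum, Rat.cast_mul, Rat.cast_natCast] at h2
      rw [Finset.sum_range_succ] at h1 h2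
      have h3 : ∑ k ∈ range n, ((n+1).choose k : ℝ) * iteratedDeriv k A 0
          = ∑ k ∈ range n, ((n+1).choose k : ℝ) * (bernoulli k : ℝ) :=
        Finset.sum_congr rfl fun k hk => by rw [ih k (Finset.mem_range.1 hk)]
      rw [h3] at h1
      have h4 : ((if n + 1 = 1 then (1:ℚ) else 0 : ℚ) : ℝ) = if n = 0 then 1 else 0 := by
        by_cases h : n = 0 <;> simp [h]
      rw [h4, ← h1] at h2
      have h5 : ((n+1).choose n : ℝ) ≠ 0 := by
        have : (n+1).choose n = n + 1 := by simp
        rw [this]; positivity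
      have h6 := add_left_cancel h2
      exact (mul_left_cancel₀ h5 h6).symm
  have h := hB (n+1)
  rw [hA, iteratedDeriv_const_add (by omega), iteratedDeriv_mul_id H H_contDiff] at h
  rw [← h]
  have : (n + 1 : ℝ) ≠ 0 := by positivity
  field_simp

end LambertAux
namespace LambertAux

lemma em_unit (K : ℕ) : ∀ (F : ℝ → ℝ), ContDiff ℝ ⊤ F → ∀ C : ℝ,
    (∀ y ∈ Set.Icc (0:ℝ) 1, |iteratedDeriv K F y| ≤ C) → ∀ x ∈ Set.Icc (0:ℝ) 1,
    |F x - (∫ y in (0:ℝ)..1, F y) - ∑ n ∈ range K, bernoulliFun (n+1) x / (n+1).factorial *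
      (iteratedDeriv n F 1 - iteratedDeriv n F 0)| ≤ 2 * C := by
  induction K with
  | zero =>
    intro F hF C hC x hx
    simp only [iteratedDeriv_zero] at hC
    have h1 := hC x hx
    have h2 : |∫ y in (0:ℝ)..1, F y| ≤ C := by
      have := intervalIntegral.norm_integral_le_of_norm_le_const (a := 0) (b := 1) (f := F) (C := C)
        (fun y hy => by
          rw [Set.uIoc_of_le zero_le_one] at hy
          exact hC y ⟨hy.1.le, hy.2⟩)
      simpa using this
    simp only [Finset.range_zero, Finset.sum_empty, sub_zero]
    have := abs_sub (F x) (∫ y in (0:ℝ)..1, F y)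
    linarith
  | succ K ih =>
    intro F hF C hC
    have hF' : ContDiff ℝ ⊤ (deriv F) := by
      have : ContDiff ℝ (⊤ + 1) F := by simpa using hF
      exact (contDiff_succ_iff_deriv.1 this).2.2
    have hC' : ∀ y ∈ Set.Icc (0:ℝ) 1, |iteratedDeriv K (deriv F) y| ≤ C := by
      intro y hy; rw [← iteratedDeriv_succ']; exact hC y hy
    have ih' := ih (deriv F) hF' C hC'
    set D : ℝ → ℝ := fun x => F x - (∫ y in (0:ℝ)..1, F y) -
      ∑ n ∈ range (K+1), bernoulliFun (n+1) x / (n+1).factorial *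
      (iteratedDeriv n F 1 - iteratedDeriv n F 0) with hD
    have hFd : Differentiable ℝ F := hF.differentiable (by simp)
    have hintF : ∫ y in (0:ℝ)..1, deriv F y = F 1 - F 0 :=
      intervalIntegral.integral_deriv_eq_sub (fun y _ => hFd y)
        (hF'.continuous.intervalIntegrable _ _)
    have hder : ∀ x, HasDerivAt D (deriv F x - (∫ y in (0:ℝ)..1, deriv F y) -
        ∑ n ∈ range K, bernoulliFun (n+1) x / (n+1).factorial *
        (iteratedDeriv n (deriv F) 1 - iteratedDeriv n (deriv F) 0)) x := by
      intro x
      have h1 : HasDerivAt D (deriv F x - ∑ n ∈ range (K+1),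
          ((n+1 : ℕ) : ℝ) * bernoulliFun n x / (n+1).factorial *
          (iteratedDeriv n F 1 - iteratedDeriv n F 0)) x := by
        refine ((hFd x).hasDerivAt.sub_const _).sub (HasDerivAt.fun_sum fun n _ => ?_)
        have := hasDerivAt_bernoulliFun (n+1) x
        simp only [Nat.add_sub_cancel] at this
        exact (this.div_const _).mul_const _
      convert h1 using 1
      rw [hintF, Finset.sum_range_succ']
      simp only [iteratedDeriv_succ', bernoulliFun_zero, iteratedDeriv_zero]
      have : ∀ n : ℕ, ((n+1+1 : ℕ) : ℝ) * bernoulliFun (n+1) x / (n+1+1).factorial =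
          bernoulliFun (n+1) x / (n+1).factorial := by
        intro n
        rw [Nat.factorial_succ (n+1)]
        push_cast
        have : (n + 1 + 1 : ℝ) ≠ 0 := by positivity
        field_simp
      simp only [this]
      simp
      ring
    have hDc : Continuous D := continuous_iff_continuousAt.2 fun x => (hder x).continuousAt
    have hlip : ∀ x ∈ Set.Icc (0:ℝ) 1, ∀ y ∈ Set.Icc (0:ℝ) 1, |D x - D y| ≤ 2 * C := by
      intro x hx y hy
      have h := (convex_Icc (0:ℝ) 1).norm_image_sub_le_of_norm_hasDerivWithin_le
        (fun z hz => (hder z).hasDerivWithinAt) (fun z hz => ih' z hz) hy hx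
      have hC0 : 0 ≤ 2 * C := by
        have := (abs_nonneg _).trans (hC' x hx); linarith
      have h3 : ‖x - y‖ ≤ 1 := by
        rw [Real.norm_eq_abs, abs_le]; constructor <;> linarith [hx.1, hx.2, hy.1, hy.2]
      calc |D x - D y| ≤ 2 * C * ‖x - y‖ := h
        _ ≤ 2 * C * 1 := by gcongr
        _ = _ := mul_one _
    have hmean : ∫ y in (0:ℝ)..1, D y = 0 := by
      rw [hD]
      have i1 : IntervalIntegrable F MeasureTheory.volume 0 1 :=
        hF.continuous.intervalIntegrable _ _
      have i2 : ∀ n ∈ range (K+1), IntervalIntegrable (fun x => bernoulliFun (n+1) x / (n+1).factorial *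
          (iteratedDeriv n F 1 - iteratedDeriv n F 0)) MeasureTheory.volume 0 1 := fun n _ =>
        ((intervalIntegrable_bernoulliFun (n+1) 0 1).div_const _).mul_const _
      have i3 : IntervalIntegrable (fun x => ∑ n ∈ range (K+1), bernoulliFun (n+1) x / (n+1).factorial *
          (iteratedDeriv n F 1 - iteratedDeriv n F 0)) MeasureTheory.volume 0 1 := by
        refine Continuous.intervalIntegrable ?_ _ _
        refine continuous_finsetSum _ fun n _ => ?_
        exact ((continuous_bernoulliFun (n+1)).div_const _).mul continuous_const
      rw [intervalIntegral.integral_sub (i1.sub (by simp)) i3,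
        intervalIntegral.integral_sub i1 (by simp), intervalIntegral.integral_finsetSum i2]
      rw [Finset.sum_eq_zero]
      · simp
      · intro n _
        rw [intervalIntegral.integral_mul_const, intervalIntegral.integral_div,
          integral_bernoulliFun_eq_zero (by omega)]
        simp
    intro x hx
    change |D x| ≤ 2 * C
    have h1 : D x = ∫ y in (0:ℝ)..1, (D x - D y) := by
      rw [intervalIntegral.integral_sub (by simp) (hDc.intervalIntegrable _ _), hmean]
      simp
    rw [h1]
    have := intervalIntegral.norm_integral_le_of_norm_le_const (a := 0) (b := 1)
      (f := fun y => D x - D y) (C := 2 * C)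
        (fun y hy => by
          rw [Set.uIoc_of_le zero_le_one] at hy
          exact hlip x hx y ⟨hy.1.le, hy.2⟩)
    simpa using this

end LambertAux
namespace LambertAux

noncomputable def psi (y : ℝ) : ℝ := deriv (fun y : ℝ => Real.log (Real.Gamma y)) y

lemma lg_diff {y : ℝ} (hy : 0 < y) :
    DifferentiableAt ℝ (fun y : ℝ => Real.log (Real.Gamma y)) y :=
  (Real.differentiableAt_Gamma (fun m => by
    have : (0:ℝ) ≤ m := m.cast_nonneg
    linarith)).log (Real.Gamma_pos_of_pos hy).ne'

lemma lg_succ {y : ℝ} (hy : 0 < y) :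
    Real.log (Real.Gamma (y+1)) = Real.log (Real.Gamma y) + Real.log y := by
  rw [Real.Gamma_add_one hy.ne', Real.log_mul hy.ne' (Real.Gamma_pos_of_pos hy).ne', add_comm]

lemma psi_succ {y : ℝ} (hy : 0 < y) : psi (y+1) = psi y + 1 / y := by
  have h1 : HasDerivAt (fun z : ℝ => Real.log (Real.Gamma (z+1))) (psi (y+1)) y := by
    have := (lg_diff (y := y+1) (by linarith)).hasDerivAt.comp_add_const y 1
    exact this
  have h2 : HasDerivAt (fun z : ℝ => Real.log (Real.Gamma z) + Real.log z) (psi y + y⁻¹) y :=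
    (lg_diff hy).hasDerivAt.add (Real.hasDerivAt_log hy.ne')
  have h3 : (fun z : ℝ => Real.log (Real.Gamma (z+1))) =ᶠ[𝓝 y]
      (fun z : ℝ => Real.log (Real.Gamma z) + Real.log z) := by
    filter_upwards [lt_mem_nhds hy] with z hz using lg_succ hz
  rw [one_div]
  exact (h1.congr_of_eventuallyEq h3.symm).unique h2

lemma psi_add_nat {y : ℝ} (hy : 0 < y) (M : ℕ) :
    psi (y + M) = psi y + ∑ m ∈ range M, 1 / (m + y) := by
  induction M with
  | zero => simp
  | succ M ih =>
    rw [Finset.sum_range_succ, ← add_assoc, ← ih]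
    push_cast
    rw [← add_assoc, psi_succ (by positivity), add_comm (M:ℝ) y]

lemma psi_le {y : ℝ} (hy : 0 < y) : psi y ≤ Real.log y := by
  have h := Real.convexOn_log_Gamma.deriv_le_slope (x := y) (y := y + 1) hy
    (by simp; linarith) (by linarith) (lg_diff hy)
  rw [slope_def_field] at h
  simp only [Function.comp, lg_succ hy] at h
  have h' : psi y ≤ _ := h
  simpa using h'

lemma le_psi {y : ℝ} (hy : 0 < y) : Real.log y ≤ psi (y+1) := by
  have h := Real.convexOn_log_Gamma.slope_le_deriv (x := y) (y := y + 1) hy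
    (by simp; linarith) (by linarith) (lg_diff (by linarith))
  rw [slope_def_field] at h
  simp only [Function.comp, lg_succ hy] at h
  have h' : _ ≤ psi (y+1) := h
  simpa using h'

lemma tendsto_harm {x : ℝ} (hx : 0 < x) :
    Tendsto (fun M : ℕ => (∑ m ∈ range M, 1 / ((m:ℝ) + x)) - Real.log M) atTop (𝓝 (- psi x)) := by
  have h1 : Tendsto (fun M : ℕ => psi (x + M) - Real.log M) atTop (𝓝 0) := by
    have a1 : Tendsto (fun M : ℕ => Real.log ((M:ℝ) + (x-1)) - Real.log M) atTop (𝓝 0) :=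
      (tendsto_log_comp_add_sub_log (x-1)).comp tendsto_natCast_atTop_atTop
    have a2 : Tendsto (fun M : ℕ => Real.log ((M:ℝ) + x) - Real.log M) atTop (𝓝 0) :=
      (tendsto_log_comp_add_sub_log x).comp tendsto_natCast_atTop_atTop
    refine tendsto_of_tendsto_of_tendsto_of_le_of_le' a1 a2 ?_ ?_
    · filter_upwards [eventually_ge_atTop 1] with M hM
      have hM' : (1:ℝ) ≤ M := by exact_mod_cast hM
      have := le_psi (y := (M:ℝ) + (x-1)) (by linarith)
      rw [show (M:ℝ) + (x-1) + 1 = x + M by ring] at this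
      linarith
    · filter_upwards with M
      have := psi_le (y := x + (M:ℝ)) (by positivity)
      rw [add_comm (M:ℝ) x]
      linarith
  have h2 := h1.sub_const (psi x)
  rw [zero_sub] at h2
  refine h2.congr fun M => ?_
  rw [psi_add_nat hx]; ring

end LambertAux
namespace LambertAux

noncomputable def phi (u : ℝ) : ℝ := 1 / (Real.exp u - 1)

lemma exp_sub_pos {u : ℝ} (hu : 0 < u) : 0 < Real.exp u - 1 := by
  have := Real.one_lt_exp_iff.2 hu; linarith

lemma phi_pos {u : ℝ} (hu : 0 < u) : 0 < phi u := one_div_pos.2 (exp_sub_pos hu)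

lemma phi_hasDerivAt {u : ℝ} (hu : 0 < u) : HasDerivAt phi (-phi u * (1 + phi u)) u := by
  have h0 := (exp_sub_pos hu).ne'
  have h := ((Real.hasDerivAt_exp u).sub_const 1).inv h0
  have h2 : phi = (fun v => Real.exp v - 1)⁻¹ := by
    funext v; simp [phi]
  rw [h2]
  refine h.congr_deriv (Eq.symm ?_)
  change -((Real.exp u - 1)⁻¹) * (1 + (Real.exp u - 1)⁻¹) = _
  field_simp
  ring

lemma phi_le {u : ℝ} (hu : 0 < u) : phi u ≤ 2 / u ^ 2 := by
  have := Real.quadratic_le_exp_of_nonneg hu.le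
  rw [phi, div_le_div_iff₀ (exp_sub_pos hu) (by positivity)]
  nlinarith

lemma H_shape (j : ℕ) : ∃ (Q : Polynomial ℝ) (c : ℝ), ∀ u > 0,
    iteratedDeriv j H u = phi u * Q.eval (phi u) + c / u ^ (j+1) := by
  induction j with
  | zero =>
    refine ⟨1, -1, fun u hu => ?_⟩
    simp only [iteratedDeriv_zero, H_of_ne hu.ne', phi, Polynomial.eval_one]
    ring
  | succ j ih =>
    obtain ⟨Q, c, h⟩ := ih
    refine ⟨-(1 + Polynomial.X) * (Q + Polynomial.X * Polynomial.derivative Q), -(j+1) * c,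
      fun u hu => ?_⟩
    rw [iteratedDeriv_succ]
    have he : iteratedDeriv j H =ᶠ[𝓝 u]
        fun u => phi u * Q.eval (phi u) + c * (u ^ (j+1))⁻¹ := by
      filter_upwards [lt_mem_nhds hu] with v hv
      rw [h v hv, div_eq_mul_inv]
    have hd := phi_hasDerivAt hu
    have h1 := (hd.mul ((Q.hasDerivAt (phi u)).comp u hd)).add
      (((hasDerivAt_pow (j+1) u).inv (pow_ne_zero _ hu.ne')).const_mul c)
    rw [he.deriv_eq]
    refine (h1.deriv).trans ?_
    simp only [Polynomial.eval_mul, Polynomial.eval_neg, Polynomial.eval_add, Polynomial.eval_one,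
      Polynomial.eval_X, Function.comp, Nat.add_sub_cancel]
    push_cast
    field_simp
    ring

lemma phi_tendsto : Tendsto phi atTop (𝓝 0) := by
  have h : Tendsto (fun u : ℝ => Real.exp u - 1) atTop atTop :=
    tendsto_atTop_add_const_right _ (-1) Real.tendsto_exp_atTop
  have := h.inv_tendsto_atTop
  refine this.congr fun u => ?_
  simp [phi]

lemma H_tendsto (j : ℕ) : Tendsto (iteratedDeriv j H) atTop (𝓝 0) := by
  obtain ⟨Q, c, h⟩ := H_shape j
  have h1 : Tendsto (fun u => phi u * Q.eval (phi u) + c / u ^ (j+1)) atTop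
      (𝓝 (0 * Q.eval 0 + 0)) := by
    refine (phi_tendsto.mul ((Q.continuous.tendsto 0).comp phi_tendsto)).add ?_
    exact (tendsto_pow_atTop (by omega)).const_div_atTop c
  simp only [zero_mul, add_zero] at h1
  refine h1.congr' ?_
  filter_upwards [eventually_gt_atTop 0] with u hu using (h u hu).symm

lemma H_decay (K : ℕ) (hK : 1 ≤ K) : ∃ C : ℝ, 0 ≤ C ∧ ∀ u : ℝ, 0 ≤ u →
    |iteratedDeriv K H u| ≤ C / (1 + u) ^ 2 := by
  obtain ⟨Q, c, h⟩ := H_shape K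
  obtain ⟨C1, hC1⟩ := (isCompact_Icc (a := (0:ℝ)) (b := 2)).exists_bound_of_continuousOn
    Q.continuous.continuousOn
  have hcont : Continuous (iteratedDeriv K H) :=
    (H_contDiff (n := ⊤)).continuous_iteratedDeriv K le_top
  obtain ⟨C2, hC2⟩ := (isCompact_Icc (a := (0:ℝ)) (b := 1)).exists_bound_of_continuousOn
    hcont.continuousOn
  have hC10 : 0 ≤ C1 := (norm_nonneg _).trans (hC1 0 (by simp))
  have hC20 : 0 ≤ C2 := (norm_nonneg _).trans (hC2 0 (by simp))
  refine ⟨8 * C1 + 4 * |c| + 4 * C2, by positivity, fun u hu => ?_⟩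
  rw [le_div_iff₀ (by positivity)]
  rcases le_total u 1 with hu1 | hu1
  · have h1 : |iteratedDeriv K H u| ≤ C2 := hC2 u ⟨hu, hu1⟩
    have h2 : (1 + u)^2 ≤ 4 := by nlinarith
    have h3 : |iteratedDeriv K H u| * (1 + u)^2 ≤ C2 * 4 := by gcongr
    have := abs_nonneg c
    linarith
  · have hu0 : 0 < u := by linarith
    have hp := phi_pos hu0
    have hle := phi_le hu0
    have hp2 : phi u ≤ 2 := hle.trans (by
      rw [div_le_iff₀ (by positivity)]; nlinarith)
    have hQ : |Q.eval (phi u)| ≤ C1 := hC1 _ ⟨hp.le, hp2⟩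
    have hpow : u ^ 2 ≤ u ^ (K+1) := pow_le_pow_right₀ hu1 (by omega)
    have h1 : |iteratedDeriv K H u| ≤ 2 / u^2 * C1 + |c| / u^2 := by
      rw [h u hu0]
      refine (abs_add_le _ _).trans ?_
      rw [abs_mul, abs_div, abs_of_pos hp, abs_of_pos (pow_pos hu0 (K+1))]
      gcongr
    have h2 : (1+u)^2 ≤ 4 * u^2 := by nlinarith
    calc |iteratedDeriv K H u| * (1 + u)^2 ≤ (2 / u^2 * C1 + |c| / u^2) * (4 * u^2) := by gcongr
      _ = 8 * C1 + 4 * |c| := by field_simp; ring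
      _ ≤ _ := by linarith

noncomputable def L (u : ℝ) : ℝ := Real.log (E u) - u

lemma L_zero : L 0 = 0 := by simp [L, E_zero]

lemma L_continuous : Continuous L := by
  have : Continuous E := continuous_iff_continuousAt.2 fun u => (E_analytic u).continuousAt
  exact (this.log fun u => (E_pos u).ne').sub continuous_id

lemma L_hasDerivAt {u : ℝ} (hu : 0 < u) : HasDerivAt L (H u) u := by
  have he : L =ᶠ[𝓝 u] fun v => Real.log (Real.exp v - 1) - Real.log v - v := by
    filter_upwards [lt_mem_nhds hu] with v hv
    rw [L, E_of_ne hv.ne', Real.log_div (exp_sub_pos hv).ne' hv.ne']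
  have h0 := (exp_sub_pos hu).ne'
  have h1 := ((((Real.hasDerivAt_exp u).sub_const 1).log h0).sub
    (Real.hasDerivAt_log hu.ne')).sub (hasDerivAt_id u)
  refine HasDerivAt.congr_of_eventuallyEq ?_ he
  refine HasDerivAt.congr_deriv (f' := Real.exp u / (Real.exp u - 1) - u⁻¹ - 1) h1 ?_
  rw [H_of_ne hu.ne']
  field_simp
  ring

lemma L_tendsto : Tendsto (fun u => L u + Real.log u) atTop (𝓝 0) := by
  have h1 : Tendsto (fun u : ℝ => Real.log (1 - Real.exp (-u))) atTop (𝓝 0) := by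
    have h2 : Tendsto (fun u : ℝ => 1 - Real.exp (-u)) atTop (𝓝 1) := by
      simpa using (Real.tendsto_exp_neg_atTop_nhds_zero).const_sub 1
    simpa using h2.log one_ne_zero
  refine h1.congr' ?_
  filter_upwards [eventually_gt_atTop 0] with u hu
  have h3 : 1 - Real.exp (-u) = (Real.exp u - 1) / Real.exp u := by
    rw [Real.exp_neg]; field_simp
  rw [L, E_of_ne hu.ne', Real.log_div (exp_sub_pos hu).ne' hu.ne', h3,
    Real.log_div (exp_sub_pos hu).ne' (Real.exp_pos u).ne', Real.log_exp]
  ring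

lemma integral_H {t : ℝ} (ht : 0 < t) (M : ℕ) :
    ∫ y in (0:ℝ)..1, H (t * (M + y)) = (L (t * (M + 1)) - L (t * M)) / t := by
  have h := intervalIntegral.integral_eq_sub_of_hasDerivAt_of_le (a := 0) (b := 1)
    (f := fun y => L (t * (M + y)) / t) (f' := fun y => H (t * (M + y))) zero_le_one
    (by have := L_continuous; fun_prop)
    (fun y hy => by
      have hpos : 0 < t * (M + y) := mul_pos ht (by have := hy.1; positivity)
      have h1 : HasDerivAt (fun y : ℝ => t * (M + y)) t y := by
        simpa using ((hasDerivAt_id y).const_add (M:ℝ)).const_mul t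
      have h2 := ((L_hasDerivAt hpos).comp y h1).div_const t
      rw [mul_div_cancel_right₀ _ ht.ne'] at h2
      exact h2)
    (by
      refine Continuous.intervalIntegrable ?_ _ _
      have := (H_contDiff (n := ⊤)).continuous
      fun_prop)
  rw [h]
  simp only [add_zero]
  ring

lemma tele {t : ℝ} (ht : 0 < t) (M : ℕ) :
    ∑ m ∈ range M, t / (1 + t * m) ^ 2 ≤ (1 + t) * (1 - 1 / (1 + t * M)) := by
  induction M with
  | zero => simp
  | succ M ih =>
    rw [Finset.sum_range_succ]
    have : t / (1 + t * M) ^ 2 ≤ (1 + t) * (1 / (1 + t * M) - 1 / (1 + t * (M + 1))) := by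
      have a : 0 < 1 + t * M := by positivity
      have b : 0 < 1 + t * (M + 1) := by positivity
      have e : (1 + t) * (1 / (1 + t * M) - 1 / (1 + t * (M + 1))) =
          (1 + t) * t / ((1 + t * M) * (1 + t * (M + 1))) := by field_simp; ring
      rw [e, div_le_div_iff₀ (by positivity) (by positivity)]
      have c : 1 + t * (M + 1) ≤ (1 + t) * (1 + t * M) := by
        have : 0 ≤ t * (t * M) := by positivity
        nlinarith
      have := mul_le_mul_of_nonneg_left c (by positivity : 0 ≤ t * (1 + t * M))
      nlinarith
    push_cast
    linarith

lemma iter_scaled (n : ℕ) (t a y : ℝ) :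
    iteratedDeriv n (fun y => H (t * (a + y))) y = t ^ n * iteratedDeriv n H (t * (a + y)) := by
  have h1 : (fun y => H (t * (a + y))) = fun y => (fun z => H (t * z)) (a + y) := rfl
  rw [h1, iteratedDeriv_comp_const_add n (fun z => H (t * z)) a,
    iteratedDeriv_comp_const_mul H_contDiff]

lemma em_sum {x : ℝ} (hx : x ∈ Set.Icc (0:ℝ) 1) (K : ℕ) {C : ℝ} (hC0 : 0 ≤ C)
    (hC : ∀ u : ℝ, 0 ≤ u → |iteratedDeriv (K+1) H u| ≤ C / (1 + u) ^ 2) {t : ℝ} (ht : 0 < t)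
    (M : ℕ) :
    |(∑ m ∈ range M, H (t * (m + x))) - L (t * M) / t -
      ∑ n ∈ range (K+1), bernoulliFun (n+1) x / (n+1).factorial *
        (t ^ n * iteratedDeriv n H (t * M) - t ^ n * iteratedDeriv n H 0)|
      ≤ 2 * C * t ^ K * ∑ m ∈ range M, t / (1 + t * m) ^ 2 := by
  induction M with
  | zero => simp [L_zero]
  | succ M ih =>
    have h := em_unit (K+1) (fun y => H (t * (M + y)))
      (by have := H_contDiff (n := ⊤); fun_prop) (t ^ (K+1) * (C / (1 + t * M) ^ 2)) (by
        intro y hy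
        have hy0 := hy.1
        rw [iter_scaled, abs_mul, abs_of_pos (pow_pos ht _)]
        have := hC (t * (M + y)) (by positivity)
        refine mul_le_mul_of_nonneg_left (this.trans ?_) (by positivity)
        gcongr
        linarith) x hx
    simp only [iter_scaled, integral_H ht, add_zero] at h
    rw [Finset.sum_range_succ, Finset.sum_range_succ (fun m : ℕ => t / (1 + t * (m:ℝ)) ^ 2),
      mul_add (2 * C * t ^ K)]
    have e2 : 2 * C * t ^ K * (t / (1 + t * M) ^ 2) = 2 * (t ^ (K+1) * (C / (1 + t * M) ^ 2)) := by
      ring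
    rw [e2]
    refine le_trans (le_of_eq ?_) ((abs_add_le _ _).trans (add_le_add ih h))
    congr 1
    have e3 : ∑ n ∈ range (K+1), bernoulliFun (n+1) x / (n+1).factorial *
        (t ^ n * iteratedDeriv n H (t * (M + 1)) - t ^ n * iteratedDeriv n H 0) =
        ∑ n ∈ range (K+1), bernoulliFun (n+1) x / (n+1).factorial *
        (t ^ n * iteratedDeriv n H (t * M) - t ^ n * iteratedDeriv n H 0) +
        ∑ n ∈ range (K+1), bernoulliFun (n+1) x / (n+1).factorial *
        (t ^ n * iteratedDeriv n H (t * (M + 1)) - t ^ n * iteratedDeriv n H (t * M)) := by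
      rw [← Finset.sum_add_distrib]
      refine Finset.sum_congr rfl fun n _ => by ring
    push_cast
    rw [e3]
    ring

/-- The double series swap. -/
lemma lambert_swap {q x : ℝ} (hq0 : 0 < q) (hq1 : q < 1) (hx : 0 < x) :
    HasSum (fun m : ℕ => phi (-Real.log q * (m + x)))
      (∑' k : ℕ, q ^ (((k : ℝ) + 1) * x) / (1 - q ^ (k + 1))) := by
  set f : ℕ × ℕ → ℝ := fun p => q ^ (((p.1 : ℝ) + 1) * (p.2 + x)) with hf
  have hf0 : ∀ p, 0 ≤ f p := fun p => (Real.rpow_pos_of_pos hq0 _).le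
  have hqk : ∀ k : ℕ, q ^ (k+1) < 1 := fun k => pow_lt_one₀ hq0.le hq1 (by omega)
  have hrow : ∀ k : ℕ, HasSum (fun m : ℕ => f (k, m)) (q ^ (((k : ℝ) + 1) * x) / (1 - q ^ (k + 1))) := by
    intro k
    have h := (hasSum_geometric_of_lt_one (pow_nonneg hq0.le (k+1)) (hqk k)).mul_left
      (q ^ (((k : ℝ) + 1) * x))
    rw [div_eq_mul_inv]
    refine h.congr_fun fun m => ?_
    simp only [hf]
    rw [← Real.rpow_natCast, ← Real.rpow_natCast, ← Real.rpow_mul hq0.le, ← Real.rpow_add hq0]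
    congr 1
    push_cast
    ring
  have hqx : q ^ x < 1 := Real.rpow_lt_one hq0.le hq1 hx
  have hqx0 : 0 < q ^ x := Real.rpow_pos_of_pos hq0 _
  have hcols : Summable (fun k : ℕ => q ^ (((k : ℝ) + 1) * x) / (1 - q ^ (k + 1))) := by
    have h := (((summable_geometric_of_lt_one hqx0.le hqx).mul_left (q ^ x)).div_const (1 - q))
    refine Summable.of_nonneg_of_le (fun k => ?_) (fun k => ?_) h
    · have := hqk k
      exact div_nonneg (Real.rpow_pos_of_pos hq0 _).le (by linarith)
    · have e : q ^ (((k : ℝ) + 1) * x) = q ^ x * (q ^ x) ^ k := by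
        rw [← Real.rpow_natCast, ← Real.rpow_mul hq0.le, ← Real.rpow_add hq0]
        congr 1; ring
      rw [e]
      have h1 : q ^ (k+1) ≤ q := pow_le_of_le_one hq0.le hq1.le (by omega)
      have h2 : 0 < 1 - q := by linarith
      gcongr
  have hS : Summable f := by
    rw [summable_prod_of_nonneg hf0]
    refine ⟨fun k => (hrow k).summable, ?_⟩
    refine hcols.congr fun k => ?_
    exact ((hrow k).tsum_eq).symm
  have hcol : ∀ m : ℕ, HasSum (fun k : ℕ => f (k, m)) (phi (-Real.log q * (m + x))) := by
    intro m
    have hmx : 0 < (m:ℝ) + x := by positivity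
    have hr0 : 0 < q ^ ((m:ℝ) + x) := Real.rpow_pos_of_pos hq0 _
    have hr1 : q ^ ((m:ℝ) + x) < 1 := Real.rpow_lt_one hq0.le hq1 hmx
    have h := (hasSum_geometric_of_lt_one hr0.le hr1).mul_left (q ^ ((m:ℝ) + x))
    have e : phi (-Real.log q * (m + x)) = q ^ ((m:ℝ) + x) * (1 - q ^ ((m:ℝ) + x))⁻¹ := by
      have : Real.exp (-Real.log q * (m + x)) = (q ^ ((m:ℝ) + x))⁻¹ := by
        rw [Real.rpow_def_of_pos hq0, ← Real.exp_neg]; congr 1; ring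
      rw [phi, this]
      have h1 : 1 - q ^ ((m:ℝ) + x) ≠ 0 := by linarith
      field_simp
    rw [e]
    refine h.congr_fun fun k => ?_
    simp only [hf]
    rw [← Real.rpow_natCast, ← Real.rpow_mul hq0.le, ← Real.rpow_add hq0]
    congr 1
    ring
  have h1 : ∑' k : ℕ, q ^ (((k : ℝ) + 1) * x) / (1 - q ^ (k + 1)) = ∑' p, f p := by
    rw [hS.tsum_prod]
    exact tsum_congr fun k => ((hrow k).tsum_eq).symm
  rw [h1]
  have h2 : HasSum (fun p : ℕ × ℕ => f p.swap) (∑' p, f p) :=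
    (Equiv.prodComm ℕ ℕ).hasSum_iff.2 hS.hasSum
  exact h2.prod_fiberwise (fun m => hcol m)

lemma main_bound {x : ℝ} (hx0 : 0 < x) (hx1 : x ≤ 1) (K : ℕ) {C : ℝ} (hC0 : 0 ≤ C)
    (hC : ∀ u : ℝ, 0 ≤ u → |iteratedDeriv (K+1) H u| ≤ C / (1 + u) ^ 2) {t S : ℝ} (ht : 0 < t)
    (hS : HasSum (fun m : ℕ => phi (t * (m + x))) S) :
    |S - (psi x + Real.log t) / (-t) + ∑ n ∈ range (K+1), bernoulliFun (n+1) x / (n+1).factorial *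
        (t ^ n * ((bernoulli (n+1) : ℝ) / (n+1)))| ≤ 2 * C * t ^ K * (1 + t) := by
  have hlim1 : Tendsto (fun M : ℕ => ∑ n ∈ range (K+1), bernoulliFun (n+1) x / (n+1).factorial *
        (t ^ n * iteratedDeriv n H (t * M) - t ^ n * iteratedDeriv n H 0)) atTop
      (𝓝 (∑ n ∈ range (K+1), bernoulliFun (n+1) x / (n+1).factorial *
        (t ^ n * 0 - t ^ n * ((bernoulli (n+1) : ℝ) / (n+1))))) := by
    refine tendsto_finsetSum _ fun n _ => ?_
    rw [← H_deriv_zero]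
    refine Tendsto.const_mul _ (Tendsto.sub_const (Tendsto.const_mul _ ?_) _)
    exact (H_tendsto n).comp (tendsto_natCast_atTop_atTop.const_mul_atTop ht)
  have hlim2 : Tendsto (fun M : ℕ => (∑ m ∈ range M, 1 / ((m:ℝ) + x)) + L (t * M)) atTop
      (𝓝 (-psi x - Real.log t)) := by
    have h1 : Tendsto (fun M : ℕ => L (t * M) + Real.log (t * M)) atTop (𝓝 0) :=
      L_tendsto.comp (tendsto_natCast_atTop_atTop.const_mul_atTop ht)
    have h2 := ((tendsto_harm hx0).add h1).sub_const (Real.log t)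
    rw [add_zero] at h2
    refine h2.congr' ?_
    filter_upwards [eventually_ge_atTop 1] with M hM
    have hM' : (M:ℝ) ≠ 0 := by positivity
    rw [Real.log_mul ht.ne' hM']
    ring
  have hlim3 : Tendsto (fun M : ℕ => (∑ m ∈ range M, H (t * (m + x))) - L (t * M) / t) atTop
      (𝓝 (S - (-psi x - Real.log t) / t)) := by
    refine (hS.tendsto_sum_nat.sub (hlim2.div_const t)).congr fun M => ?_
    have : ∀ m : ℕ, H (t * (m + x)) = phi (t * (m + x)) - (1 / ((m:ℝ) + x)) / t := by
      intro m
      have hm : 0 < (m:ℝ) + x := by positivity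
      rw [H_of_ne (mul_pos ht hm).ne', phi]
      congr 1
      field_simp
    simp only [this, Finset.sum_sub_distrib, ← Finset.sum_div]
    ring
  have hfin := (hlim3.sub hlim1).abs
  have hle := le_of_tendsto hfin (Eventually.of_forall fun M =>
    (em_sum ⟨hx0.le, hx1⟩ K hC0 hC ht M).trans (b := _) (c := 2 * C * t ^ K * (1 + t)) (by
      have h1 := tele ht M
      have h2 : (0:ℝ) ≤ 1 / (1 + t * M) := by positivity
      have h3 : (1 + t) * (1 - 1 / (1 + t * M)) ≤ 1 + t := by nlinarith
      exact mul_le_mul_of_nonneg_left (h1.trans h3) (by positivity)))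
  refine le_trans (le_of_eq ?_) hle
  congr 1
  simp only [mul_zero, zero_sub, mul_neg, Finset.sum_neg_distrib]
  field_simp
  ring

end LambertAux

/-- Asymptotic expansion of the Lambert series `𝓛_q(0,x)` near `q = 1`,
where `ψ` is the digamma function (logarithmic derivative of the Gamma function). -/
theorem lambert_zero_asymptotic (x : ℝ) (hx0 : 0 < x) (hx1 : x ≤ 1)
    (N : ℕ) (hN : 1 ≤ N) :
    (fun q : ℝ =>
        (((∑' k : ℕ, q ^ (((k : ℝ) + 1) * x) / (1 - q ^ (k + 1))) : ℝ) : ℂ)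
        - ((((deriv (fun y : ℝ => Real.log (Real.Gamma y)) x
                + Real.log (Real.log (1 / q))) / Real.log q : ℝ) : ℂ)
            - ∑ k ∈ Finset.Icc 1 N,
                riemannZeta (1 - (k : ℂ)) / (Nat.factorial k : ℂ) *
                  ((Polynomial.aeval x (Polynomial.bernoulli k) : ℝ) : ℂ) *
                  ((Real.log q : ℂ)) ^ (k - 1)))
      =O[𝓝[Set.Ioo (0 : ℝ) 1] 1] fun q : ℝ => (Real.log (1 / q)) ^ N := by
  obtain ⟨C, hC0, hC⟩ := LambertAux.H_decay (N+1) (by omega)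
  set d : ℝ := bernoulliFun (N+1) x / (N+1).factorial * ((bernoulli (N+1) : ℝ) / (N+1)) with hd
  refine IsBigO.of_bound (2 * C * 2 + |d|) ?_
  have hnear : ∀ᶠ q : ℝ in 𝓝[Set.Ioo (0 : ℝ) 1] 1, Real.exp (-1) < q :=
    nhdsWithin_le_nhds (lt_mem_nhds (by simp))
  filter_upwards [self_mem_nhdsWithin, hnear] with q hq hq2
  obtain ⟨hq0, hq1⟩ := hq
  set t : ℝ := -Real.log q with ht
  have htl : Real.log (1 / q) = t := by simp [ht]
  have hlq : Real.log q = -t := by simp [ht]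
  have ht0 : 0 < t := by have := Real.log_neg hq0 hq1; linarith
  have ht1 : t ≤ 1 := by
    have := (Real.lt_log_iff_exp_lt hq0).2 hq2; linarith
  have hb := LambertAux.main_bound hx0 hx1 N hC0 hC ht0 (LambertAux.lambert_swap hq0 hq1 hx0)
  have hsum : ∑ k ∈ Finset.Icc 1 N,
                riemannZeta (1 - (k : ℂ)) / (Nat.factorial k : ℂ) *
                  ((Polynomial.aeval x (Polynomial.bernoulli k) : ℝ) : ℂ) *
                  ((Real.log q : ℂ)) ^ (k - 1)
      = ((∑ n ∈ range N, bernoulliFun (n+1) x / (n+1).factorial *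
        (t ^ n * ((bernoulli (n+1) : ℝ) / (n+1))) : ℝ) : ℂ) := by
    have hI : Finset.Icc 1 N = Finset.Ico 1 (N+1) := by ext k; simp
    rw [hI, Finset.sum_Ico_eq_sum_range, Complex.ofReal_sum]
    refine Finset.sum_congr (by simp) fun n _ => ?_
    have hz : riemannZeta (1 - ((1 + n : ℕ) : ℂ)) = (-1) ^ n * (bernoulli (n+1) : ℂ) / (n+1) := by
      rw [← riemannZeta_neg_nat_eq_bernoulli]
      congr 1; push_cast; ring
    have hbf : (Polynomial.aeval x (Polynomial.bernoulli (n+1)) : ℝ) = bernoulliFun (n+1) x := by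
      rw [bernoulliFun, Polynomial.eval_map_algebraMap]
    rw [hz, add_comm 1 n, hbf, hlq, Nat.add_sub_cancel]
    push_cast
    have h1 : ((-1 : ℂ) ^ n) * (-1) ^ n = 1 := by rw [← mul_pow]; simp
    rw [neg_pow (t : ℂ) n]
    linear_combination ((bernoulli (n+1) : ℂ) / (n+1) / ((n+1).factorial : ℂ) *
      (bernoulliFun (n+1) x : ℂ) * (t : ℂ) ^ n) * h1
  rw [hsum, htl, hlq]
  set S := ∑' k : ℕ, q ^ (((k : ℝ) + 1) * x) / (1 - q ^ (k + 1))
  rw [← Complex.ofReal_sub, ← Complex.ofReal_sub, Complex.norm_real, Real.norm_eq_abs,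
    Real.norm_eq_abs, abs_of_pos (pow_pos ht0 N)]
  rw [Finset.sum_range_succ] at hb
  have hb2 : 2 * C * t ^ N * (1 + t) ≤ 2 * C * 2 * t ^ N := by
    have : 0 ≤ 2 * C * t ^ N := by positivity
    nlinarith
  have hlast : bernoulliFun (N+1) x / (N+1).factorial * (t ^ N * ((bernoulli (N+1) : ℝ) / (N+1)))
      = d * t ^ N := by rw [hd]; ring
  rw [hlast] at hb
  have hdt : |d * t ^ N| = |d| * t ^ N := by rw [abs_mul, abs_of_pos (pow_pos ht0 N)]
  have htri := abs_sub (S - (LambertAux.psi x + Real.log t) / (-t) +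
    (∑ n ∈ range N, bernoulliFun (n+1) x / (n+1).factorial *
        (t ^ n * ((bernoulli (n+1) : ℝ) / (n+1))) + d * t ^ N)) (d * t ^ N)
  have heq : S - ((deriv (fun y : ℝ => Real.log (Real.Gamma y)) x + Real.log t) / (-t) -
      ∑ n ∈ range N, bernoulliFun (n+1) x / (n+1).factorial *
        (t ^ n * ((bernoulli (n+1) : ℝ) / (n+1)))) =
      S - (LambertAux.psi x + Real.log t) / (-t) +
    (∑ n ∈ range N, bernoulliFun (n+1) x / (n+1).factorial *
        (t ^ n * ((bernoulli (n+1) : ℝ) / (n+1))) + d * t ^ N) - d * t ^ N := by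
    rw [LambertAux.psi]; ring
  rw [heq]
  linarith
end
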